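/- There is an absolute constant C > 0 such that for all sufficiently large real x, with L = (log x)^{10} and D = exp((log log x)^3), if A₁ is the set of natural numbers n ≤ x of the form n = d·p with all prime factors of d at most L, d ≤ D, p prime, and n > x/L, then M(A₁) ≤ (1 + C·(log log x)/log x) · x/log x. -/

import Mathlib

open scoped BigOperators

/-- `M A` is the largest cardinality of a subset of `A` on which the Euler totient
function is nondecreasing. -/
noncomputable def M (A : Set ℕ) : ℕ :=
  sSup {k : ℕ | ∃ B : Finset ℕ, ↑B ⊆ A ∧
    (∀ m ∈ B, ∀ n ∈ B, m ≤ n → Nat.totient m ≤ Nat.totient n) ∧ B.card = k}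

/-- The scale `L = (log x)^10`. -/
noncomputable def Lx (x : ℝ) : ℝ := (Real.log x) ^ 10

/-- The scale `D = exp((log log x)^3)`. -/
noncomputable def Dx (x : ℝ) : ℝ := Real.exp ((Real.log (Real.log x)) ^ 3)

/-- Membership in the primary set `A₁`: `n = d * p` with `d` an `L`-smooth number of size
at most `D`, `p` prime, and `n > x / L`. -/
def inA1 (x : ℝ) (n : ℕ) : Prop :=
  x / Lx x < (n : ℝ) ∧ ∃ d p : ℕ, n = d * p ∧
    (∀ q : ℕ, q.Prime → q ∣ d → (q : ℝ) ≤ Lx x) ∧ (d : ℝ) ≤ Dx x ∧ p.Prime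

open Complex in
/-- The term comparing `n⁻ˢ` with `∫ x⁻ˢ` over `[n, n + 1]`, multiplied by `s - 1`. -/
noncomputable def zetaTerm (n : ℕ) (s : ℂ) : ℂ :=
  (s - 1) * (n : ℂ) ^ (-s) + ((n + 1 : ℕ) : ℂ) ^ (1 - s) - (n : ℂ) ^ (1 - s)

lemma hasDerivAt_ofReal_cpow_of_pos {x : ℝ} (hx : 0 < x) (r : ℂ) :
    HasDerivAt (fun y : ℝ => (y : ℂ) ^ r) (r * (x : ℂ) ^ (r - 1)) x := by
  have := (hasDerivAt_id (x : ℂ)).cpow_const (c := r) (Or.inl (by simpa using hx))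
  simpa using this.comp_ofReal

lemma norm_cpow_neg_sub_cpow_neg_le {n x : ℝ} (hn : 1 ≤ n) (hx : x ∈ Set.Icc n (n + 1)) {s : ℂ}
    (hs : 0 < s.re) {θ : ℝ} (hθ : θ ∈ Set.Icc (0 : ℝ) 1) :
    ‖(n : ℂ) ^ (-s) - (x : ℂ) ^ (-s)‖ ≤ 2 * ‖s‖ ^ θ * n ^ (-s.re - θ) := by
  have hn0 : 0 < n := by linarith
  have hx0 : 0 < x := hn0.trans_le hx.1
  have h1 : ‖(n : ℂ) ^ (-s) - (x : ℂ) ^ (-s)‖ ≤ 2 * n ^ (-s.re) := by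
    refine (norm_sub_le _ _).trans ?_
    rw [Complex.norm_cpow_eq_rpow_re_of_pos hn0, Complex.norm_cpow_eq_rpow_re_of_pos hx0]
    have : x ^ (-s).re ≤ n ^ (-s).re :=
      Real.rpow_le_rpow_of_nonpos hn0 hx.1 (by simpa using hs.le)
    simp only [Complex.neg_re] at *
    linarith
  have h2 : ‖(n : ℂ) ^ (-s) - (x : ℂ) ^ (-s)‖ ≤ 2 * (‖s‖ * n ^ (-s.re - 1)) := by
    have := Convex.norm_image_sub_le_of_norm_hasDerivWithin_le (𝕜 := ℝ)
      (f := fun y : ℝ => (y : ℂ) ^ (-s)) (f' := fun y => -s * (y : ℂ) ^ (-s - 1))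
      (C := ‖s‖ * n ^ (-s.re - 1)) (s := Set.Icc n (n + 1)) (x := x) (y := n)
      (fun y hy => (hasDerivAt_ofReal_cpow_of_pos (hn0.trans_le hy.1) _).hasDerivWithinAt)
      (fun y hy => by
        rw [norm_mul, norm_neg, Complex.norm_cpow_eq_rpow_re_of_pos (hn0.trans_le hy.1)]
        gcongr
        simpa using Real.rpow_le_rpow_of_nonpos hn0 hy.1 (by linarith : -s.re - 1 ≤ 0))
      (convex_Icc _ _) hx ⟨le_rfl, by linarith⟩
    refine this.trans ?_
    have h3 : ‖n - x‖ ≤ 1 := by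
      rw [Real.norm_eq_abs, abs_le]; constructor <;> linarith [hx.1, hx.2]
    have h4 : 0 ≤ ‖s‖ * n ^ (-s.re - 1) := by positivity
    nlinarith
  have hb : 0 ≤ ‖(n : ℂ) ^ (-s) - (x : ℂ) ^ (-s)‖ := norm_nonneg _
  generalize ‖(n : ℂ) ^ (-s) - (x : ℂ) ^ (-s)‖ = b at *
  calc b = b ^ (1 - θ) * b ^ θ := by
        rw [← Real.rpow_add_of_nonneg hb (by linarith [hθ.2]) hθ.1]; simp
    _ ≤ (2 * n ^ (-s.re)) ^ (1 - θ) * (2 * (‖s‖ * n ^ (-s.re - 1))) ^ θ := by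
        gcongr
        · linarith [hθ.2]
        · exact hθ.1
    _ = 2 * ‖s‖ ^ θ * n ^ (-s.re - θ) := by
        rw [Real.mul_rpow (by norm_num) (by positivity), Real.mul_rpow (by norm_num) (by positivity),
          Real.mul_rpow (by positivity) (by positivity), ← Real.rpow_mul hn0.le,
          ← Real.rpow_mul hn0.le]
        have e1 : (2 : ℝ) ^ (1 - θ) * 2 ^ θ = 2 := by
          rw [← Real.rpow_add (by norm_num)]; simp
        have e2 : n ^ (-s.re * (1 - θ)) * n ^ ((-s.re - 1) * θ) = n ^ (-s.re - θ) := by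
          rw [← Real.rpow_add hn0]; ring_nf
        calc _ = ((2 : ℝ) ^ (1 - θ) * 2 ^ θ) * ‖s‖ ^ θ *
              (n ^ (-s.re * (1 - θ)) * n ^ ((-s.re - 1) * θ)) := by ring
          _ = _ := by rw [e1, e2]

lemma norm_zetaTerm_le {n : ℕ} (hn : 1 ≤ n) {s : ℂ}
    (hs : 0 < s.re) {θ : ℝ} (hθ : θ ∈ Set.Icc (0 : ℝ) 1) :
    ‖zetaTerm n s‖ ≤ ‖s - 1‖ * (2 * ‖s‖ ^ θ * (n : ℝ) ^ (-s.re - θ)) := by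
  have hn' : (1 : ℝ) ≤ n := by exact_mod_cast hn
  have hn0 : (0 : ℝ) < n := by linarith
  have := Convex.norm_image_sub_le_of_norm_hasDerivWithin_le (𝕜 := ℝ)
      (f := fun y : ℝ => (s - 1) * (n : ℂ) ^ (-s) * y + (y : ℂ) ^ (1 - s))
      (f' := fun y => (s - 1) * (n : ℂ) ^ (-s) * 1 + (1 - s) * (y : ℂ) ^ (1 - s - 1))
      (C := ‖s - 1‖ * (2 * ‖s‖ ^ θ * (n : ℝ) ^ (-s.re - θ))) (s := Set.Icc (n : ℝ) (n + 1))
      (x := n) (y := n + 1)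
      (fun y hy => (((hasDerivAt_id (y : ℂ)).comp_ofReal.const_mul _).add
        (hasDerivAt_ofReal_cpow_of_pos (hn0.trans_le hy.1) _)).hasDerivWithinAt)
      (fun y hy => by
        have : (s - 1) * (n : ℂ) ^ (-s) * 1 + (1 - s) * (y : ℂ) ^ (1 - s - 1) =
          (s - 1) * (((n : ℝ) : ℂ) ^ (-s) - (y : ℂ) ^ (-s)) := by
            rw [show 1 - s - 1 = -s by ring]; push_cast; ring
        rw [this, norm_mul]
        gcongr
        exact norm_cpow_neg_sub_cpow_neg_le hn' hy hs hθ)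
      (convex_Icc _ _) ⟨le_rfl, by linarith⟩ ⟨by linarith, le_rfl⟩
  simp only [add_sub_cancel_left, norm_one, mul_one] at this
  convert! this using 2
  rw [zetaTerm]
  push_cast
  ring

lemma differentiable_zetaTerm {n : ℕ} (hn : 1 ≤ n) : Differentiable ℂ (zetaTerm n) := by
  have h0 : (n : ℂ) ≠ 0 := by exact_mod_cast (by omega : n ≠ 0)
  have h1 : ((n + 1 : ℕ) : ℂ) ≠ 0 := by exact_mod_cast (by omega : n + 1 ≠ 0)
  unfold zetaTerm
  intro s
  refine ((DifferentiableAt.mul (by fun_prop) ?_).add ?_).sub ?_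
  · exact DifferentiableAt.const_cpow (by fun_prop) (Or.inl h0)
  · exact DifferentiableAt.const_cpow (by fun_prop) (Or.inl h1)
  · exact DifferentiableAt.const_cpow (by fun_prop) (Or.inl h0)

lemma hasSum_zetaTerm_of_one_lt_re {s : ℂ} (hs : 1 < s.re) :
    HasSum (fun n : ℕ => zetaTerm (n + 1) s) (riemannZeta₁ s - 1) := by
  have hs1 : s ≠ 1 := by rintro rfl; simp at hs
  have h1 : HasSum (fun n : ℕ => ((n + 1 : ℕ) : ℂ) ^ (-s)) (riemannZeta s) := by
    have h := (zeta_eq_tsum_one_div_nat_add_one_cpow hs)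
    have hsum := (summable_nat_add_iff 1).2 (Complex.summable_one_div_nat_cpow.2 hs)
    rw [h]
    convert! hsum.hasSum using 2 with n
    · rw [Complex.cpow_neg, one_div]
    · push_cast; rfl
  have h2 : HasSum (fun n : ℕ => ((n + 1 + 1 : ℕ) : ℂ) ^ (1 - s) - ((n + 1 : ℕ) : ℂ) ^ (1 - s))
      (0 - 1) := by
    have hsum : Summable (fun n : ℕ => ((n + 1 + 1 : ℕ) : ℂ) ^ (1 - s) -
        ((n + 1 : ℕ) : ℂ) ^ (1 - s)) := by
      have hb : Summable (fun n : ℕ => ‖s - 1‖ * ‖((n + 1 : ℕ) : ℂ) ^ (-s)‖ +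
          ‖s - 1‖ * (2 * ‖s‖ ^ (0:ℝ) * ((n + 1 : ℕ) : ℝ) ^ (-s.re - 0))) := by
        refine (h1.summable.norm.mul_left _).add ((Summable.mul_left _ ?_).mul_left _)
        exact (summable_nat_add_iff 1 (f := fun n : ℕ => (n : ℝ) ^ (-s.re - 0))).2
          (Real.summable_nat_rpow.2 (by linarith))
      refine Summable.of_norm_bounded hb fun n => ?_
      have := norm_zetaTerm_le (n := n + 1) (by omega) (s := s) (by linarith) (θ := 0) (by simp)
      have e : ((n + 1 + 1 : ℕ) : ℂ) ^ (1 - s) - ((n + 1 : ℕ) : ℂ) ^ (1 - s) =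
        zetaTerm (n + 1) s - (s - 1) * ((n + 1 : ℕ) : ℂ) ^ (-s) := by
          rw [zetaTerm]; ring
      rw [e]
      refine (norm_sub_le _ _).trans ?_
      rw [norm_mul (s - 1)]
      linarith
    rw [hsum.hasSum_iff_tendsto_nat]
    have := fun m : ℕ => Finset.sum_range_sub (fun n : ℕ => ((n + 1 : ℕ) : ℂ) ^ (1 - s)) m
    simp only [this]
    simp only [zero_add, Nat.cast_one, Complex.one_cpow]
    refine Filter.Tendsto.sub_const ?_ _
    rw [tendsto_zero_iff_norm_tendsto_zero]
    have e : ∀ n : ℕ, ‖((n + 1 : ℕ) : ℂ) ^ (1 - s)‖ = ((n + 1 : ℕ) : ℝ) ^ (-(s.re - 1)) := by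
      intro n
      rw [Complex.norm_natCast_cpow_of_pos (by omega)]
      simp
    simp only [e]
    exact ((tendsto_rpow_neg_atTop (by linarith)).comp tendsto_natCast_atTop_atTop).comp
      (Filter.tendsto_add_atTop_nat 1)
  have := (h1.mul_left (s - 1)).add h2
  convert! this using 1
  · ext n; rw [zetaTerm]; ring
  · rw [riemannZeta_eq_inv_sub_mul hs1]
    field_simp [sub_ne_zero.2 hs1]
    ring

lemma norm_riemannZeta₁_le {ε : ℝ} (h0 : 0 < ε) (h1 : ε ≤ 1 / 4) :
    ∃ C : ℝ, 0 < C ∧ ∀ s : ℂ, 1 - ε < s.re → s.re ≤ 3 →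
      ‖riemannZeta₁ s‖ ≤ C * (|s.im| + 4) ^ (1 + 2 * ε) := by
  have hsum : Summable (fun n : ℕ => ((n + 1 : ℕ) : ℝ) ^ (-1 - ε)) :=
    (summable_nat_add_iff 1 (f := fun n : ℕ => (n : ℝ) ^ (-1 - ε))).2
      (Real.summable_nat_rpow.2 (by linarith))
  set K := ∑' n : ℕ, ((n + 1 : ℕ) : ℝ) ^ (-1 - ε) with hK
  have hK0 : 0 ≤ K := tsum_nonneg fun n => by positivity
  have key : ∀ (n : ℕ) (s : ℂ), 1 - ε < s.re →
      ‖zetaTerm (n + 1) s‖ ≤ 2 * ‖s - 1‖ * ‖s‖ ^ (2 * ε) * ((n + 1 : ℕ) : ℝ) ^ (-1 - ε) := by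
    intro n s hs
    refine (norm_zetaTerm_le (n := n + 1) (by omega) (s := s) (by linarith) (θ := 2 * ε)
      ⟨by linarith, by linarith⟩).trans ?_
    have : ((n + 1 : ℕ) : ℝ) ^ (-s.re - 2 * ε) ≤ ((n + 1 : ℕ) : ℝ) ^ (-1 - ε) :=
      Real.rpow_le_rpow_of_exponent_le (by norm_cast; omega) (by linarith)
    calc _ ≤ ‖s - 1‖ * (2 * ‖s‖ ^ (2 * ε) * ((n + 1 : ℕ) : ℝ) ^ (-1 - ε)) := by gcongr
      _ = _ := by ring
  -- analytic continuation of the series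
  have hopen : IsOpen {s : ℂ | 1 - ε < s.re} := isOpen_lt continuous_const Complex.continuous_re
  have hconv : Convex ℝ {s : ℂ | 1 - ε < s.re} := convex_halfSpace_re_gt _
  have hdiff : DifferentiableOn ℂ (fun s => ∑' n : ℕ, zetaTerm (n + 1) s)
      {s : ℂ | 1 - ε < s.re} := by
    intro s hs
    set R := ‖s‖ + 1
    have hU : IsOpen ({s : ℂ | 1 - ε < s.re} ∩ Metric.ball 0 R) := hopen.inter Metric.isOpen_ball
    have hsU : s ∈ {s : ℂ | 1 - ε < s.re} ∩ Metric.ball 0 R := ⟨hs, by simp [R]⟩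
    have := Complex.differentiableOn_tsum_of_summable_norm
      (u := fun n : ℕ => 2 * (R + 1) * R ^ (2 * ε) * ((n + 1 : ℕ) : ℝ) ^ (-1 - ε))
      (hsum.mul_left _) (fun n => (differentiable_zetaTerm (n := n + 1)
        (by omega)).differentiableOn) hU (fun n w hw => by
          refine (key n w hw.1).trans ?_
          have hw2 : ‖w‖ ≤ R := (mem_ball_zero_iff.1 hw.2).le
          have hw3 : ‖w - 1‖ ≤ R + 1 := (norm_sub_le _ _).trans (by simpa using hw2)
          gcongr)
    exact ((this s hsU).differentiableAt (hU.mem_nhds hsU)).differentiableWithinAt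
  have heq : Set.EqOn (fun s => riemannZeta₁ s - 1) (fun s => ∑' n : ℕ, zetaTerm (n + 1) s)
      {s : ℂ | 1 - ε < s.re} := by
    refine AnalyticOnNhd.eqOn_of_preconnected_of_eventuallyEq (z₀ := 2) ?_
      (hdiff.analyticOnNhd hopen) hconv.isPreconnected (by simp; linarith) ?_
    · exact ((differentiable_riemannZeta₁.sub_const 1).differentiableOn).analyticOnNhd hopen
    · have : {s : ℂ | 1 < s.re} ∈ nhds (2 : ℂ) :=
        (isOpen_lt continuous_const Complex.continuous_re).mem_nhds (by simp)
      filter_upwards [this] with s hs using (hasSum_zetaTerm_of_one_lt_re hs).tsum_eq.symm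
  refine ⟨1 + 2 * K, by positivity, fun s hs hs3 => ?_⟩
  have e := heq hs
  simp only at e
  have hT : 1 ≤ |s.im| + 4 := by linarith [abs_nonneg s.im]
  have hn1 : ‖s‖ ≤ |s.im| + 4 := by
    have := Complex.norm_le_abs_re_add_abs_im s
    rw [abs_of_pos (by linarith : 0 < s.re)] at this
    linarith
  have hn2 : ‖s - 1‖ ≤ |s.im| + 4 := by
    have := Complex.norm_le_abs_re_add_abs_im (s - 1)
    have h3 : |(s - 1).re| ≤ 4 := by
      simp only [Complex.sub_re, Complex.one_re]
      rw [abs_le]; constructor <;> linarith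
    simp only [Complex.sub_im, Complex.one_im, sub_zero] at this
    linarith
  have h4 : ‖∑' n : ℕ, zetaTerm (n + 1) s‖ ≤ 2 * ‖s - 1‖ * ‖s‖ ^ (2 * ε) * K := by
    rw [hK, ← tsum_mul_left]
    exact tsum_of_norm_bounded (hsum.mul_left _).hasSum fun n => key n s hs
  set T := |s.im| + 4
  have h5 : 2 * ‖s - 1‖ * ‖s‖ ^ (2 * ε) * K ≤ 2 * K * T ^ (1 + 2 * ε) := by
    rw [Real.rpow_add (by linarith), Real.rpow_one]
    calc 2 * ‖s - 1‖ * ‖s‖ ^ (2 * ε) * K ≤ 2 * T * T ^ (2 * ε) * K := by gcongr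
      _ = _ := by ring
  have h6 : 1 ≤ T ^ (1 + 2 * ε) := Real.one_le_rpow hT (by linarith)
  calc ‖riemannZeta₁ s‖ = ‖1 + ∑' n : ℕ, zetaTerm (n + 1) s‖ := by rw [← e]; ring_nf
    _ ≤ 1 + 2 * ‖s - 1‖ * ‖s‖ ^ (2 * ε) * K := (norm_add_le _ _).trans (by simpa using h4)
    _ ≤ _ := by linarith

lemma norm_deriv_riemannZeta₁_le {ε : ℝ} (h0 : 0 < ε) (h1 : ε ≤ 1 / 4) :
    ∃ C : ℝ, 0 < C ∧ ∀ s : ℂ, 1 - ε / 4 ≤ s.re → s.re ≤ 2 →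
      ‖deriv riemannZeta₁ s‖ ≤ C * (|s.im| + 4) ^ (1 + 2 * ε) := by
  obtain ⟨C, hC, h⟩ := norm_riemannZeta₁_le h0 h1
  refine ⟨C * 2 ^ (1 + 2 * ε) / (ε / 2), by positivity, fun s hs hs2 => ?_⟩
  have := Complex.norm_deriv_le_of_forall_mem_sphere_norm_le (c := s) (R := ε / 2)
    (C := C * (2 * (|s.im| + 4)) ^ (1 + 2 * ε)) (f := riemannZeta₁) (by positivity)
    differentiable_riemannZeta₁.diffContOnCl (fun z hz => by
      have hz' : ‖z - s‖ = ε / 2 := by simpa [dist_eq_norm] using hz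
      have hre := (Complex.abs_re_le_norm (z - s)).trans hz'.le
      have him := (Complex.abs_im_le_norm (z - s)).trans hz'.le
      rw [Complex.sub_re, abs_le] at hre
      rw [Complex.sub_im] at him
      refine (h z (by linarith [hre.1]) (by linarith [hre.2])).trans ?_
      have : |z.im| ≤ |s.im| + 1 := by
        have := abs_sub_abs_le_abs_sub z.im s.im
        linarith
      gcongr
      linarith [abs_nonneg s.im])
  refine this.trans (le_of_eq ?_)
  rw [Real.mul_rpow (by norm_num) (by positivity)]
  ring

lemma one_le_norm_zeta_product {σ t : ℝ} (hσ : 1 < σ) :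
    1 ≤ ‖riemannZeta σ‖ ^ 3 * ‖riemannZeta (σ + t * Complex.I)‖ ^ 4 *
      ‖riemannZeta (σ + 2 * t * Complex.I)‖ := by
  have := DirichletCharacter.norm_LSeries_product_ge_one (N := 1) 1 (x := σ - 1)
    (by linarith) t
  simp only [one_pow, norm_mul, norm_pow] at this
  have e : ∀ s : ℂ, 1 < s.re →
      LSeries (fun n => (1 : DirichletCharacter ℂ 1) n) s = riemannZeta s := by
    intro s hs
    rw [← LSeries_one_eq_riemannZeta hs]
    congr 1
    ext n
    simp [Subsingleton.elim (n : ZMod 1) 1]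
  rw [e _ (by simp [hσ]), e _ (by simp [hσ]), e _ (by simp [hσ])] at this
  have e0 : (1 : ℂ) + ((σ - 1 : ℝ) : ℂ) = σ := by push_cast; ring
  rw [e0, mul_comm Complex.I, mul_right_comm 2 Complex.I] at this
  exact this

lemma le_norm_riemannZeta₁ {ε : ℝ} (h0 : 0 < ε) (h1 : ε ≤ 1 / 4) :
    ∃ c : ℝ, 0 < c ∧ ∀ s : ℂ, 1 ≤ s.re → s.re ≤ 2 →
      c * (|s.im| + 4) ^ (1 - 8 * ε) ≤ ‖riemannZeta₁ s‖ := by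
  obtain ⟨C, hC, hZ⟩ := norm_riemannZeta₁_le h0 h1
  obtain ⟨C2, hC2, hZ'⟩ := norm_deriv_riemannZeta₁_le h0 h1
  -- the fourth power bound off the line
  have step1 : ∃ c1 : ℝ, 0 < c1 ∧ ∀ σ t : ℝ, 1 < σ → σ ≤ 2 → 1 ≤ |t| →
      c1 * (σ - 1) ^ 3 * (|t| + 4) ^ (-(2 * ε)) * (|t| + 4) ^ 4 ≤
        ‖riemannZeta₁ (σ + t * Complex.I)‖ ^ 4 := by
    set K := C * 4 ^ (1 + 2 * ε) with hK
    have hKpos : 0 < K := by positivity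
    refine ⟨(K ^ 3 * 5 ^ 4 * (C * 2 ^ (1 + 2 * ε) * 5))⁻¹, by positivity, ?_⟩
    intro σ t hσ hσ2 ht
    set T := |t| + 4 with hT
    have hT0 : 0 < T := by positivity
    have htT : T / 5 ≤ |t| := by rw [hT]; linarith
    have b1 : ‖riemannZeta σ‖ ≤ K / (σ - 1) := by
      rw [riemannZeta_eq_inv_sub_mul (by norm_cast; linarith), norm_mul, norm_inv]
      have : ‖(σ : ℂ) - 1‖ = σ - 1 := by
        rw [← Complex.ofReal_one, ← Complex.ofReal_sub, Complex.norm_real, Real.norm_eq_abs,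
          abs_of_pos (by linarith)]
      rw [this, div_eq_inv_mul]
      gcongr
      simpa [hK] using hZ σ (by simp; linarith) (by simp; linarith)
    have b2 : ‖riemannZeta (σ + t * Complex.I)‖ ≤
        5 * ‖riemannZeta₁ (σ + t * Complex.I)‖ / T := by
      rw [riemannZeta_eq_inv_sub_mul, norm_mul, norm_inv]
      · have : T / 5 ≤ ‖(σ + t * Complex.I : ℂ) - 1‖ :=
          htT.trans (by simpa using Complex.abs_im_le_norm ((σ + t * Complex.I : ℂ) - 1))
        calc _ ≤ (T / 5)⁻¹ * ‖riemannZeta₁ (σ + t * Complex.I)‖ := by gcongr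
          _ = _ := by field_simp
      · intro h
        have := congrArg Complex.re h
        simp at this; linarith
    have b3 : ‖riemannZeta (σ + 2 * t * Complex.I)‖ ≤
        C * 2 ^ (1 + 2 * ε) * 5 * T ^ (2 * ε) := by
      rw [riemannZeta_eq_inv_sub_mul, norm_mul, norm_inv]
      · have : T / 5 ≤ ‖(σ + 2 * t * Complex.I : ℂ) - 1‖ := by
          refine htT.trans ?_
          have := Complex.abs_im_le_norm ((σ + 2 * t * Complex.I : ℂ) - 1)
          simp [abs_mul] at this
          linarith [abs_nonneg t]
        have h2 := hZ (σ + 2 * t * Complex.I) (by simp; linarith) (by simp; linarith)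
        have h3 : |(σ + 2 * t * Complex.I : ℂ).im| + 4 ≤ 2 * T := by
          simp [abs_mul, hT]; linarith
        calc _ ≤ (T / 5)⁻¹ * (C * (2 * T) ^ (1 + 2 * ε)) := by
              gcongr
              exact h2.trans (by gcongr)
          _ = _ := by
            rw [Real.mul_rpow (by norm_num) hT0.le, Real.rpow_add hT0 1, Real.rpow_one]
            field_simp
      · intro h
        have := congrArg Complex.re h
        simp at this; linarith
    have hprod := one_le_norm_zeta_product (σ := σ) (t := t) hσ
    set z := ‖riemannZeta₁ (σ + t * Complex.I)‖
    have hσ' : 0 < σ - 1 := by linarith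
    have h4 : 1 ≤ (K / (σ - 1)) ^ 3 * (5 * z / T) ^ 4 * (C * 2 ^ (1 + 2 * ε) * 5 * T ^ (2 * ε)) := by
      refine hprod.trans ?_
      gcongr
    rw [Real.rpow_neg hT0.le]
    have hP : 0 < T ^ (2 * ε) := by positivity
    have hQ : (0 : ℝ) < 2 ^ (1 + 2 * ε) := by positivity
    calc _ = (K ^ 3 * 5 ^ 4 * (C * 2 ^ (1 + 2 * ε) * 5))⁻¹ * (σ - 1) ^ 3 * (T ^ (2 * ε))⁻¹ *
          T ^ 4 * 1 := by ring
      _ ≤ (K ^ 3 * 5 ^ 4 * (C * 2 ^ (1 + 2 * ε) * 5))⁻¹ * (σ - 1) ^ 3 * (T ^ (2 * ε))⁻¹ *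
          T ^ 4 * ((K / (σ - 1)) ^ 3 * (5 * z / T) ^ 4 *
            (C * 2 ^ (1 + 2 * ε) * 5 * T ^ (2 * ε))) := by gcongr
      _ = _ := by field_simp
  obtain ⟨c1, hc1, h4⟩ := step1
  -- the region with large imaginary part
  have step2 : ∃ c2 : ℝ, 0 < c2 ∧ ∀ s : ℂ, 1 ≤ s.re → s.re ≤ 2 → 1 ≤ |s.im| →
      c2 * (|s.im| + 4) ^ (1 - 8 * ε) ≤ ‖riemannZeta₁ s‖ := by
    set c0 := min 1 (c1 / (16 * C2 ^ 4)) with hc0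
    have hc0p : 0 < c0 := by positivity
    refine ⟨c0 * C2, by positivity, fun s hs hs2 ht => ?_⟩
    set T := |s.im| + 4 with hT
    have hT0 : 0 < T := by positivity
    have hT1 : 1 ≤ T := by linarith
    set η := c0 * T ^ (-(10 * ε)) with hη
    have hη0 : 0 < η := by positivity
    have hη1 : η ≤ 1 := by
      have : T ^ (-(10 * ε)) ≤ 1 := Real.rpow_le_one_of_one_le_of_nonpos hT1 (by linarith)
      have : c0 ≤ 1 := min_le_left _ _
      calc η ≤ 1 * 1 := by rw [hη]; gcongr
        _ = 1 := one_mul 1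
    set σ := max s.re (1 + η) with hσ
    have hσ1 : 1 + η ≤ σ := le_max_right _ _
    have hσ2 : σ ≤ 2 := max_le hs2 (by linarith)
    have hσs : |s.re - σ| ≤ η := by
      rw [abs_le]
      constructor
      · rcases max_cases s.re (1 + η) with h | h <;> rw [hσ] <;> linarith [h.1]
      · have : s.re ≤ σ := le_max_left _ _
        linarith
    have hlow := h4 σ s.im (by linarith) hσ2 ht
    have hdiff : ‖riemannZeta₁ (σ + s.im * Complex.I) - riemannZeta₁ s‖ ≤
        C2 * T ^ (1 + 2 * ε) * η := by
      have := Convex.norm_image_sub_le_of_norm_deriv_le (𝕜 := ℂ) (f := riemannZeta₁)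
        (C := C2 * T ^ (1 + 2 * ε)) (s := {w : ℂ | w.re ∈ Set.Icc 1 2 ∧ w.im ∈ Set.Icc s.im s.im})
        (x := s) (y := σ + s.im * Complex.I) (fun _ _ => differentiable_riemannZeta₁ _)
        (fun w hw => by
          have := hZ' w (by linarith [hw.1.1]) hw.1.2
          have e : w.im = s.im := le_antisymm hw.2.2 hw.2.1
          rwa [e] at this)
        (((convex_Icc (1 : ℝ) 2).linear_preimage Complex.reLm).inter
          ((convex_Icc s.im s.im).linear_preimage Complex.imLm))
        ⟨⟨hs, hs2⟩, by simp⟩ ⟨by simp; constructor <;> linarith, by simp⟩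
      refine this.trans ?_
      gcongr
      have e : (σ + s.im * Complex.I : ℂ) - s = ((σ - s.re : ℝ) : ℂ) := by
        apply Complex.ext <;> simp
      rw [e, Complex.norm_real, Real.norm_eq_abs, abs_sub_comm]
      exact hσs
    have hbig : 2 * (C2 * T ^ (1 + 2 * ε) * η) ≤ ‖riemannZeta₁ (σ + s.im * Complex.I)‖ := by
      refine le_of_pow_le_pow_left₀ (n := 4) (by norm_num) (norm_nonneg _) (le_trans ?_ hlow)
      have hηle : η * (16 * C2 ^ 4) ≤ c1 * T ^ (-(10 * ε)) := by
        have : c0 ≤ c1 / (16 * C2 ^ 4) := min_le_right _ _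
        rw [le_div_iff₀ (by positivity)] at this
        calc η * (16 * C2 ^ 4) = c0 * (16 * C2 ^ 4) * T ^ (-(10 * ε)) := by rw [hη]; ring
          _ ≤ _ := by gcongr
      have e1 : (T ^ (1 + 2 * ε)) ^ 4 = T ^ 4 * T ^ (8 * ε) := by
        rw [← Real.rpow_natCast, ← Real.rpow_mul hT0.le, ← Real.rpow_natCast T 4,
          ← Real.rpow_add hT0]
        congr 1; push_cast; ring
      have e2 : T ^ (-(10 * ε)) * T ^ (8 * ε) = T ^ (-(2 * ε)) := by
        rw [← Real.rpow_add hT0]; ring_nf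
      calc (2 * (C2 * T ^ (1 + 2 * ε) * η)) ^ 4
          = (η * (16 * C2 ^ 4)) * η ^ 3 * (T ^ (1 + 2 * ε)) ^ 4 := by ring
        _ ≤ (c1 * T ^ (-(10 * ε))) * (σ - 1) ^ 3 * (T ^ (1 + 2 * ε)) ^ 4 := by
            gcongr
            linarith
        _ = c1 * (σ - 1) ^ 3 * (T ^ (-(10 * ε)) * T ^ (8 * ε)) * T ^ 4 := by rw [e1]; ring
        _ = _ := by rw [e2]
    have e3 : c0 * C2 * T ^ (1 - 8 * ε) = C2 * T ^ (1 + 2 * ε) * η := by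
      rw [hη, show (1 - 8 * ε) = (1 + 2 * ε) + -(10 * ε) by ring, Real.rpow_add hT0]; ring
    rw [e3]
    have := norm_sub_norm_le (riemannZeta₁ (σ + s.im * Complex.I)) (riemannZeta₁ s)
    linarith
  obtain ⟨c2, hc2, h5⟩ := step2
  -- the compact region
  have step3 : ∃ c3 : ℝ, 0 < c3 ∧ ∀ s : ℂ, 1 ≤ s.re → s.re ≤ 2 → |s.im| ≤ 1 →
      c3 ≤ ‖riemannZeta₁ s‖ := by
    have hK : IsCompact (Set.Icc (1 : ℝ) 2 ×ℂ Set.Icc (-1 : ℝ) 1) :=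
      isCompact_Icc.reProdIm isCompact_Icc
    obtain ⟨w, hw, hmin⟩ := hK.exists_isMinOn (f := fun s => ‖riemannZeta₁ s‖)
      ⟨1, by simp [Complex.mem_reProdIm]⟩
      differentiable_riemannZeta₁.continuous.norm.continuousOn
    refine ⟨‖riemannZeta₁ w‖, ?_, fun s h1 h2 h3 => hmin ?_⟩
    · rw [norm_pos_iff]
      intro h0
      rcases eq_or_ne w 1 with rfl | hne
      · simp at h0
      · apply riemannZeta_ne_zero_of_one_le_re (s := w) hw.1.1
        rw [riemannZeta_eq_inv_sub_mul hne, h0, mul_zero]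
    · exact ⟨⟨h1, h2⟩, abs_le.1 h3⟩
  obtain ⟨c3, hc3, h6⟩ := step3
  refine ⟨min c2 (c3 / 5), by positivity, fun s hs hs2 => ?_⟩
  rcases le_total 1 |s.im| with h | h
  · refine le_trans ?_ (h5 s hs hs2 h)
    gcongr
    exact min_le_left _ _
  · refine le_trans ?_ (h6 s hs hs2 h)
    have hT : (|s.im| + 4) ^ (1 - 8 * ε) ≤ 5 := by
      calc (|s.im| + 4) ^ (1 - 8 * ε) ≤ (|s.im| + 4) ^ (1 : ℝ) :=
            Real.rpow_le_rpow_of_exponent_le (by linarith [abs_nonneg s.im]) (by linarith)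
        _ ≤ 5 := by rw [Real.rpow_one]; linarith
    calc _ ≤ c3 / 5 * 5 := by
          gcongr
          exact min_le_right _ _
      _ = c3 := by ring

/-- The Laplace transform of the normalised error term of `∑ Λ(n) (x - n)₊`. -/
noncomputable def errorTransform (s : ℂ) : ℂ :=
  -deriv riemannZeta₁ s / (riemannZeta₁ s * (s * (s + 1)))

lemma riemannZeta₁_ne_zero_of_one_le_re {s : ℂ} (hs : 1 ≤ s.re) : riemannZeta₁ s ≠ 0 := by
  intro h0
  rcases eq_or_ne s 1 with rfl | hne
  · simp at h0
  · apply riemannZeta_ne_zero_of_one_le_re (s := s) hs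
    rw [riemannZeta_eq_inv_sub_mul hne, h0, mul_zero]

lemma differentiableAt_errorTransform {s : ℂ} (hs : 0 < s.re) (hZ : riemannZeta₁ s ≠ 0) :
    DifferentiableAt ℂ errorTransform s := by
  have h1 : s ≠ 0 := by rintro rfl; simp at hs
  have h2 : s + 1 ≠ 0 := by
    intro h
    have := congrArg Complex.re h
    simp at this; linarith
  have := differentiable_riemannZeta₁.deriv
  unfold errorTransform
  exact (this.neg s).div ((differentiable_riemannZeta₁ s).mul (by fun_prop))
    (mul_ne_zero hZ (mul_ne_zero h1 h2))

lemma norm_iteratedDeriv_errorTransform_le (k : ℕ) :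
    ∃ C : ℝ, 0 < C ∧ ∀ s : ℂ, 1 ≤ s.re → s.re ≤ 3 / 2 →
      ‖iteratedDeriv k errorTransform s‖ ≤ C * (|s.im| + 4) ^ (-(3 / 2) : ℝ) := by
  set ε : ℝ := 1 / (20 * (k + 1)) with hε
  have h0 : 0 < ε := by positivity
  have hεk : 10 * ε * (k + 1) = 1 / 2 := by rw [hε]; field_simp; norm_num
  have hk0 : (0 : ℝ) ≤ k := by positivity
  have h1 : ε ≤ 1 / 20 := by nlinarith
  have h1' : ε ≤ 1 / 4 := by linarith
  obtain ⟨C, hC, hZ'⟩ := norm_deriv_riemannZeta₁_le h0 h1'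
  obtain ⟨c, hc, hlow⟩ := le_norm_riemannZeta₁ h0 h1'
  set D := C * 2 ^ (1 + 2 * ε) with hD
  have hD0 : 0 < D := by positivity
  set c3 := min (ε / 4) (c / (2 * D)) with hc3
  have hc30 : 0 < c3 := by positivity
  set E := D / (c / 2 * (1 / 16) ^ 2) with hE
  refine ⟨k.factorial * E / c3 ^ k, by positivity, fun s hs hs2 => ?_⟩
  set T := |s.im| + 4 with hT
  have hT4 : 4 ≤ T := by linarith [abs_nonneg s.im]
  have hT0 : 0 < T := by linarith
  set r := c3 * T ^ (-(10 * ε)) with hr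
  have hr0 : 0 < r := by positivity
  have hTle : T ^ (-(10 * ε)) ≤ 1 :=
    Real.rpow_le_one_of_one_le_of_nonpos (by linarith) (by linarith)
  have hr1 : r ≤ ε / 4 := by
    calc r ≤ ε / 4 * 1 := by
          rw [hr]; gcongr
          exact min_le_left _ _
      _ = _ := mul_one _
  have hrD : r * D ≤ c / 2 * T ^ (-(10 * ε)) := by
    have : c3 ≤ c / (2 * D) := min_le_right _ _
    rw [le_div_iff₀ (by positivity)] at this
    calc r * D = (c3 * (2 * D)) / 2 * T ^ (-(10 * ε)) := by rw [hr]; ring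
      _ ≤ _ := by gcongr
  -- points of the disc
  have hpts : ∀ z ∈ Metric.closedBall s r, 1 - ε / 4 ≤ z.re ∧ z.re ≤ 2 ∧ |z.im| + 4 ≤ 2 * T ∧
      T ≤ 16 * ‖z‖ ∧ T ≤ 16 * ‖z + 1‖ := by
    intro z hz
    have hz' : ‖z - s‖ ≤ r := by simpa [dist_eq_norm] using hz
    have hre := (Complex.abs_re_le_norm (z - s)).trans hz'
    have him := (Complex.abs_im_le_norm (z - s)).trans hz'
    rw [Complex.sub_re, abs_le] at hre
    rw [Complex.sub_im] at him
    have i1 := abs_sub_abs_le_abs_sub z.im s.im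
    have i2 := abs_sub_abs_le_abs_sub s.im z.im
    rw [abs_sub_comm] at i2
    have n1 := Complex.abs_im_le_norm z
    have n2 := Complex.abs_re_le_norm z
    have n3 := Complex.abs_im_le_norm (z + 1)
    have n4 := Complex.abs_re_le_norm (z + 1)
    simp only [Complex.add_im, Complex.one_im, add_zero, Complex.add_re, Complex.one_re] at n3 n4
    have n5 := le_abs_self z.re
    have n6 := le_abs_self (z.re + 1)
    refine ⟨by linarith [hre.1], by linarith [hre.2], by linarith, ?_, ?_⟩ <;> linarith [hre.1]
  have hZ'' : ∀ z ∈ Metric.closedBall s r, ‖deriv riemannZeta₁ z‖ ≤ D * T ^ (1 + 2 * ε) := by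
    intro z hz
    obtain ⟨a1, a2, a3, -, -⟩ := hpts z hz
    calc _ ≤ C * (|z.im| + 4) ^ (1 + 2 * ε) := hZ' z a1 a2
      _ ≤ C * (2 * T) ^ (1 + 2 * ε) := by gcongr
      _ = _ := by rw [Real.mul_rpow (by norm_num) hT0.le]; ring
  have hZlow : ∀ z ∈ Metric.closedBall s r, c / 2 * T ^ (1 - 8 * ε) ≤ ‖riemannZeta₁ z‖ := by
    intro z hz
    have hd := Convex.norm_image_sub_le_of_norm_deriv_le (𝕜 := ℂ) (f := riemannZeta₁)
      (fun _ _ => differentiable_riemannZeta₁ _) hZ'' (convex_closedBall s r)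
      hz (Metric.mem_closedBall_self hr0.le)
    have hz' : ‖s - z‖ ≤ r := by
      rw [norm_sub_rev]; simpa [dist_eq_norm] using hz
    have e : T ^ (-(10 * ε)) * T ^ (1 + 2 * ε) = T ^ (1 - 8 * ε) := by
      rw [← Real.rpow_add hT0]; ring_nf
    have h2 : D * T ^ (1 + 2 * ε) * ‖s - z‖ ≤ c / 2 * T ^ (1 - 8 * ε) := by
      calc _ ≤ D * T ^ (1 + 2 * ε) * r := by gcongr
        _ = r * D * T ^ (1 + 2 * ε) := by ring
        _ ≤ c / 2 * T ^ (-(10 * ε)) * T ^ (1 + 2 * ε) := by gcongr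
        _ = _ := by rw [← e]; ring
    have h3 := hlow s hs (by linarith)
    have h4 := norm_sub_norm_le (riemannZeta₁ s) (riemannZeta₁ z)
    linarith
  have hbound : ∀ z ∈ Metric.closedBall s r, ‖errorTransform z‖ ≤ E * T ^ (-2 + 10 * ε) := by
    intro z hz
    obtain ⟨a1, a2, a3, a4, a5⟩ := hpts z hz
    rw [errorTransform, norm_div, norm_neg, norm_mul, norm_mul]
    have e : T ^ (-2 + 10 * ε) = T ^ (1 + 2 * ε) / (T ^ (1 - 8 * ε) * T ^ 2) := by
      rw [← Real.rpow_natCast T 2, ← Real.rpow_add hT0, ← Real.rpow_sub hT0]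
      congr 1; push_cast; ring
    calc _ ≤ D * T ^ (1 + 2 * ε) / (c / 2 * T ^ (1 - 8 * ε) * (T / 16 * (T / 16))) := by
          gcongr
          · exact hZ'' z hz
          · exact hZlow z hz
          · linarith
          · linarith
      _ = _ := by rw [e, hE]; field_simp
  have hdiff : DiffContOnCl ℂ errorTransform (Metric.ball s r) := by
    refine DifferentiableOn.diffContOnCl fun z hz => ?_
    have hz := Metric.closure_ball_subset_closedBall hz
    refine (differentiableAt_errorTransform (by linarith [(hpts z hz).1]) ?_).differentiableWithinAt
    rw [← norm_pos_iff]
    exact lt_of_lt_of_le (by positivity) (hZlow z hz)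
  refine (Complex.norm_iteratedDeriv_le_of_forall_mem_sphere_norm_le k hr0 hdiff
    fun z hz => hbound z (Metric.sphere_subset_closedBall hz)).trans (le_of_eq ?_)
  have e : T ^ (-(3 / 2) : ℝ) = T ^ (-2 + 10 * ε) / (T ^ (-(10 * ε))) ^ k := by
    rw [← Real.rpow_natCast, ← Real.rpow_mul hT0.le, ← Real.rpow_sub hT0]
    congr 1; linarith
  rw [e, hr]
  field_simp
  ring

/-- The kernel `e⁻ᵘ (1 - n e⁻ᵘ)₊` of the Riesz mean of order one. -/
noncomputable def rieszKernel (n : ℕ) (u : ℝ) : ℝ :=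
  Real.exp (-u) * max 0 (1 - n * Real.exp (-u))

lemma continuous_rieszKernel (n : ℕ) : Continuous (rieszKernel n) := by
  unfold rieszKernel
  fun_prop

lemma rieszKernel_nonneg (n : ℕ) (u : ℝ) : 0 ≤ rieszKernel n u := by
  unfold rieszKernel
  positivity

lemma rieszKernel_le (n : ℕ) (u : ℝ) : rieszKernel n u ≤ Real.exp (-u) := by
  unfold rieszKernel
  refine mul_le_of_le_one_right (Real.exp_pos _).le (max_le zero_le_one ?_)
  have : 0 ≤ (n : ℝ) * Real.exp (-u) := by positivity
  linarith

lemma rieszKernel_eq_zero {n : ℕ} {u : ℝ} (h : Real.exp u ≤ n) : rieszKernel n u = 0 := by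
  unfold rieszKernel
  rw [max_eq_left, mul_zero]
  rw [Real.exp_neg, sub_nonpos, ← div_eq_mul_inv]
  exact (one_le_div (Real.exp_pos _)).2 h

lemma rieszKernel_of_le {n : ℕ} {u : ℝ} (h : (n : ℝ) ≤ Real.exp u) :
    rieszKernel n u = Real.exp (-u) - n * Real.exp (-(2 * u)) := by
  unfold rieszKernel
  rw [max_eq_right, mul_sub, mul_one, mul_left_comm, ← Real.exp_add]
  · ring_nf
  rw [Real.exp_neg, sub_nonneg, ← div_eq_mul_inv]
  exact (div_le_one (Real.exp_pos _)).2 h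

lemma rieszKernel_mul_cexp_eq_indicator {n : ℕ} (hn : n ≠ 0) (w : ℂ) (u : ℝ) :
    (rieszKernel n u : ℂ) * Complex.exp (-w * u) = (Set.Ioi (Real.log n)).indicator
      (fun u : ℝ => Complex.exp (-(w + 1) * u) - n * Complex.exp (-(w + 2) * u)) u := by
  have hn' : (0 : ℝ) < n := by positivity
  by_cases h : Real.log n < u
  · rw [Set.indicator_of_mem (by exact h), rieszKernel_of_le]
    · push_cast
      rw [sub_mul, mul_assoc, ← Complex.exp_add, ← Complex.exp_add]
      ring_nf
    · rw [← Real.log_le_iff_le_exp hn']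
      exact h.le
  · rw [Set.indicator_of_notMem (by simpa using h), rieszKernel_eq_zero]
    · simp
    · rw [← Real.le_log_iff_exp_le hn']
      linarith

lemma integrable_rieszKernel_mul_cexp {n : ℕ} (hn : n ≠ 0) {w : ℂ} (hw : 0 < w.re) :
    MeasureTheory.Integrable fun u : ℝ => (rieszKernel n u : ℂ) * Complex.exp (-w * u) := by
  simp_rw [rieszKernel_mul_cexp_eq_indicator hn w]
  rw [MeasureTheory.integrable_indicator_iff measurableSet_Ioi]
  refine (integrableOn_exp_mul_complex_Ioi ?_ _).sub
    ((integrableOn_exp_mul_complex_Ioi ?_ _).const_mul _)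
  · simp; linarith
  · simp; linarith

lemma integral_rieszKernel_mul_cexp {n : ℕ} (hn : n ≠ 0) {w : ℂ} (hw : 0 < w.re) :
    ∫ u : ℝ, (rieszKernel n u : ℂ) * Complex.exp (-w * u) =
      (n : ℂ) ^ (-(w + 1)) / ((w + 1) * (w + 2)) := by
  have hw1 : w + 1 ≠ 0 := by
    intro h; have := congrArg Complex.re h; simp at this; linarith
  have hw2 : w + 2 ≠ 0 := by
    intro h; have := congrArg Complex.re h; simp at this; linarith
  have h1 : (-(w + 1)).re < 0 := by simp; linarith
  have h2 : (-(w + 2)).re < 0 := by simp; linarith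
  have hn' : (n : ℂ) ≠ 0 := by exact_mod_cast hn
  simp_rw [rieszKernel_mul_cexp_eq_indicator hn w]
  rw [MeasureTheory.integral_indicator measurableSet_Ioi, MeasureTheory.integral_sub
    (integrableOn_exp_mul_complex_Ioi h1 _) ((integrableOn_exp_mul_complex_Ioi h2 _).const_mul _),
    MeasureTheory.integral_const_mul, integral_exp_mul_complex_Ioi h1,
    integral_exp_mul_complex_Ioi h2]
  have e (a : ℂ) : Complex.exp (a * (Real.log n : ℝ)) = (n : ℂ) ^ a := by
    rw [Complex.cpow_def_of_ne_zero hn', ← Complex.natCast_log, mul_comm]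
  rw [e, e]
  have e2 : (n : ℂ) ^ (-(w + 1)) = n * (n : ℂ) ^ (-(w + 2)) := by
    rw [show -(w + 1) = 1 + -(w + 2) by ring, Complex.cpow_add _ _ hn', Complex.cpow_one]
  rw [e2]
  field_simp
  ring

lemma integral_norm_rieszKernel_mul_cexp_le {n : ℕ} (hn : n ≠ 0) {w : ℂ} (hw : 0 < w.re) :
    ∫ u : ℝ, ‖(rieszKernel n u : ℂ) * Complex.exp (-w * u)‖ ≤ (n : ℝ) ^ (-(w.re + 1)) := by
  have hre : 0 < (w.re : ℂ).re := by simpa using hw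
  have h : ∀ u : ℝ, ((‖(rieszKernel n u : ℂ) * Complex.exp (-w * u)‖ : ℝ) : ℂ) =
      (rieszKernel n u : ℂ) * Complex.exp (-(w.re : ℂ) * u) := by
    intro u
    rw [norm_mul, Complex.norm_exp, Complex.norm_real, Real.norm_of_nonneg (rieszKernel_nonneg n u)]
    simp
  have h2 := integral_rieszKernel_mul_cexp hn hre
  simp_rw [← h] at h2
  rw [integral_complex_ofReal] at h2
  have h3 : ∫ u : ℝ, ‖(rieszKernel n u : ℂ) * Complex.exp (-w * u)‖ =
      (n : ℝ) ^ (-(w.re + 1)) / ((w.re + 1) * (w.re + 2)) := by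
    apply Complex.ofReal_injective
    rw [h2]
    push_cast
    rw [Complex.ofReal_cpow (by positivity)]
    push_cast
    rfl
  rw [h3]
  apply div_le_self (by positivity)
  nlinarith

open ArithmeticFunction in
/-- The normalised error `e⁻²ᵘ (∑ Λ(n) (eᵘ - n)₊ - (eᵘ - 1)₊² / 2)`. -/
noncomputable def rieszError (u : ℝ) : ℝ :=
  (∑' n : ℕ, Λ n * rieszKernel n u) - max 0 (1 - Real.exp (-u)) ^ 2 / 2

open ArithmeticFunction in
lemma tsum_rieszKernel_eq_sum {u : ℝ} {N : ℕ} (h : Real.exp u ≤ N + 1) :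
    ∑' n : ℕ, Λ n * rieszKernel n u = ∑ n ∈ Finset.Ioc 0 N, Λ n * rieszKernel n u := by
  refine tsum_eq_sum fun n hn => ?_
  rcases Nat.eq_zero_or_pos n with rfl | h0
  · simp
  · have : N + 1 ≤ n := by simp at hn; have := hn h0; omega
    rw [rieszKernel_eq_zero, mul_zero]
    refine h.trans ?_
    exact_mod_cast this

open ArithmeticFunction in
lemma continuous_rieszError : Continuous rieszError := by
  unfold rieszError
  refine Continuous.sub ?_ (by fun_prop)
  rw [continuous_iff_continuousAt]
  intro u
  have hev : (fun v => ∑ n ∈ Finset.Ioc 0 ⌈Real.exp (u + 1)⌉₊, Λ n * rieszKernel n v) =ᶠ[nhds u]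
      fun v => ∑' n : ℕ, Λ n * rieszKernel n v := by
    filter_upwards [Iio_mem_nhds (show u < u + 1 by linarith)] with v hv
    rw [tsum_rieszKernel_eq_sum]
    have : Real.exp v ≤ Real.exp (u + 1) := Real.exp_le_exp.2 (le_of_lt hv)
    have := Nat.le_ceil (Real.exp (u + 1))
    linarith
  refine ContinuousAt.congr ?_ hev
  refine Continuous.continuousAt (continuous_finsetSum _ fun n _ => ?_)
  exact (continuous_rieszKernel n).const_mul _

lemma rieszError_of_nonpos {u : ℝ} (hu : u ≤ 0) : rieszError u = 0 := by
  unfold rieszError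
  have h1 : Real.exp u ≤ 1 := Real.exp_le_one_iff.2 hu
  have h2 : 1 ≤ Real.exp (-u) := Real.one_le_exp (by linarith)
  rw [tsum_rieszKernel_eq_sum (N := 0) (by simpa using h1), max_eq_left (by linarith)]
  simp

open ArithmeticFunction in
lemma rieszError_bounded : ∃ C : ℝ, 0 < C ∧ ∀ u, |rieszError u| ≤ C := by
  have hlog : 0 < Real.log 4 := Real.log_pos (by norm_num)
  refine ⟨Real.log 4 + 5, by linarith, fun u => ?_⟩
  rcases le_or_gt u 0 with hu | hu
  · rw [rieszError_of_nonpos hu]; simp; linarith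
  have h1 : 0 ≤ ∑' n : ℕ, Λ n * rieszKernel n u :=
    tsum_nonneg fun n => mul_nonneg vonMangoldt_nonneg (rieszKernel_nonneg n u)
  have h2 : ∑' n : ℕ, Λ n * rieszKernel n u ≤ Real.log 4 + 4 := by
    rw [tsum_rieszKernel_eq_sum (N := ⌊Real.exp u⌋₊) (Nat.lt_floor_add_one _).le]
    calc _ ≤ ∑ n ∈ Finset.Ioc 0 ⌊Real.exp u⌋₊, Λ n * Real.exp (-u) :=
          Finset.sum_le_sum fun n _ =>
            mul_le_mul_of_nonneg_left (rieszKernel_le n u) vonMangoldt_nonneg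
      _ = Chebyshev.psi (Real.exp u) * Real.exp (-u) := by
          rw [← Finset.sum_mul, Chebyshev.psi]
      _ ≤ ((Real.log 4 + 4) * Real.exp u) * Real.exp (-u) := by
          gcongr
          exact Chebyshev.psi_le_const_mul_self (Real.exp_pos _).le
      _ = _ := by rw [mul_assoc, ← Real.exp_add]; simp
  have h3 : 0 ≤ max 0 (1 - Real.exp (-u)) := le_max_left _ _
  have h4 : max 0 (1 - Real.exp (-u)) ≤ 1 :=
    max_le zero_le_one (by have := Real.exp_pos (-u); linarith)
  unfold rieszError
  rw [abs_le]
  constructor <;> nlinarith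

lemma max_sq_mul_cexp_eq_indicator (w : ℂ) (u : ℝ) :
    ((max 0 (1 - Real.exp (-u)) ^ 2 / 2 : ℝ) : ℂ) * Complex.exp (-w * u) =
      (Set.Ioi (0 : ℝ)).indicator (fun u : ℝ => (1 / 2 * Complex.exp (-w * u) -
        Complex.exp (-(w + 1) * u)) + 1 / 2 * Complex.exp (-(w + 2) * u)) u := by
  by_cases h : 0 < u
  · rw [Set.indicator_of_mem (by exact h), max_eq_right]
    · push_cast
      rw [show -(w + 1) * (u : ℂ) = -u + -w * u by ring,
        show -(w + 2) * (u : ℂ) = -u + -u + -w * u by ring, Complex.exp_add, Complex.exp_add,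
        Complex.exp_add]
      ring
    · rw [sub_nonneg]; exact Real.exp_le_one_iff.2 (by linarith)
  · rw [Set.indicator_of_notMem (by simpa using h), max_eq_left]
    · simp
    · rw [sub_nonpos]; exact Real.one_le_exp (by linarith)

lemma integral_max_sq_mul_cexp {w : ℂ} (hw : 0 < w.re) :
    MeasureTheory.Integrable (fun u : ℝ =>
      ((max 0 (1 - Real.exp (-u)) ^ 2 / 2 : ℝ) : ℂ) * Complex.exp (-w * u)) ∧
    ∫ u : ℝ, ((max 0 (1 - Real.exp (-u)) ^ 2 / 2 : ℝ) : ℂ) * Complex.exp (-w * u) =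
      1 / (w * (w + 1) * (w + 2)) := by
  have hw0 : w ≠ 0 := by rintro rfl; simp at hw
  have hw1 : w + 1 ≠ 0 := by
    intro h; have := congrArg Complex.re h; simp at this; linarith
  have hw2 : w + 2 ≠ 0 := by
    intro h; have := congrArg Complex.re h; simp at this; linarith
  have h0 : (-w).re < 0 := by simp; linarith
  have h1 : (-(w + 1)).re < 0 := by simp; linarith
  have h2 : (-(w + 2)).re < 0 := by simp; linarith
  have i0 := (integrableOn_exp_mul_complex_Ioi h0 0).const_mul (1 / 2)
  have i1 := integrableOn_exp_mul_complex_Ioi h1 0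
  have i2 := (integrableOn_exp_mul_complex_Ioi h2 0).const_mul (1 / 2)
  have i01 : MeasureTheory.Integrable (fun u : ℝ => 1 / 2 * Complex.exp (-w * u) -
      Complex.exp (-(w + 1) * u)) (MeasureTheory.volume.restrict (Set.Ioi 0)) := i0.sub i1
  simp_rw [max_sq_mul_cexp_eq_indicator w]
  refine ⟨(MeasureTheory.integrable_indicator_iff measurableSet_Ioi).2 (i01.add i2), ?_⟩
  rw [MeasureTheory.integral_indicator measurableSet_Ioi,
    MeasureTheory.integral_add i01 i2, MeasureTheory.integral_sub i0 i1,
    MeasureTheory.integral_const_mul, MeasureTheory.integral_const_mul,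
    integral_exp_mul_complex_Ioi h0, integral_exp_mul_complex_Ioi h1,
    integral_exp_mul_complex_Ioi h2]
  simp only [Complex.ofReal_zero, mul_zero, Complex.exp_zero]
  field_simp
  ring

open ArithmeticFunction in
lemma hasSum_vonMangoldt_rieszKernel {w : ℂ} (hw : 0 < w.re) :
    ∫ u : ℝ, ((∑' n : ℕ, Λ n * rieszKernel n u : ℝ) : ℂ) * Complex.exp (-w * u) =
      LSeries (fun n => (Λ n : ℂ)) (w + 1) / ((w + 1) * (w + 2)) := by
  set F : ℕ → ℝ → ℂ := fun n u => (Λ n : ℂ) * ((rieszKernel n u : ℂ) * Complex.exp (-w * u))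
  have hs : 1 < (w + 1).re := by simp; linarith
  have hterm : ∀ n : ℕ, LSeries.term (fun n => (Λ n : ℂ)) (w + 1) n =
      (Λ n : ℂ) * (n : ℂ) ^ (-(w + 1)) := by
    intro n
    rcases Nat.eq_zero_or_pos n with rfl | h0
    · simp
    · rw [LSeries.term_of_ne_zero h0.ne', Complex.cpow_neg, div_eq_mul_inv]
  have hFint : ∀ n, MeasureTheory.Integrable (F n) := by
    intro n
    rcases Nat.eq_zero_or_pos n with rfl | h0
    · simp [F]
    · exact (integrable_rieszKernel_mul_cexp h0.ne' hw).const_mul _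
  have hval : ∀ n, ∫ u, F n u =
      LSeries.term (fun n => (Λ n : ℂ)) (w + 1) n / ((w + 1) * (w + 2)) := by
    intro n
    rcases Nat.eq_zero_or_pos n with rfl | h0
    · simp [F]
    · simp only [F]
      rw [MeasureTheory.integral_const_mul, integral_rieszKernel_mul_cexp h0.ne' hw, hterm]
      ring
  have hsum : Summable fun n => ∫ u, ‖F n u‖ := by
    have := (LSeriesSummable_vonMangoldt hs).norm
    refine Summable.of_nonneg_of_le (fun n => MeasureTheory.integral_nonneg fun u => norm_nonneg _)
      (fun n => ?_) this
    rcases Nat.eq_zero_or_pos n with rfl | h0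
    · simp [F]
    · simp only [F, norm_mul (Λ n : ℂ)]
      rw [MeasureTheory.integral_const_mul, hterm, norm_mul, Complex.norm_natCast_cpow_of_pos h0]
      gcongr
      exact integral_norm_rieszKernel_mul_cexp_le h0.ne' hw
  have key := MeasureTheory.hasSum_integral_of_summable_integral_norm hFint hsum
  have h2 : ∀ u : ℝ, ∑' n, F n u =
      ((∑' n : ℕ, Λ n * rieszKernel n u : ℝ) : ℂ) * Complex.exp (-w * u) := by
    intro u
    rw [Complex.ofReal_tsum, ← tsum_mul_right]
    refine tsum_congr fun n => ?_
    simp only [F]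
    push_cast
    ring
  simp_rw [h2] at key
  rw [← key.tsum_eq, LSeries, ← tsum_div_const]
  exact tsum_congr hval

lemma integrable_rieszError_mul_cexp {w : ℂ} (hw : 0 < w.re) :
    MeasureTheory.Integrable fun u : ℝ => (rieszError u : ℂ) * Complex.exp (-w * u) := by
  obtain ⟨C, hC, hb⟩ := rieszError_bounded
  have h0 : (-w).re < 0 := by simp; linarith
  have h : (fun u : ℝ => (rieszError u : ℂ) * Complex.exp (-w * u)) =
      (Set.Ioi (0 : ℝ)).indicator (fun u : ℝ => (rieszError u : ℂ) * Complex.exp (-w * u)) := by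
    ext u
    by_cases h : 0 < u
    · rw [Set.indicator_of_mem (by exact h)]
    · rw [Set.indicator_of_notMem (by simpa using h), rieszError_of_nonpos (by linarith)]
      simp
  rw [h, MeasureTheory.integrable_indicator_iff measurableSet_Ioi]
  refine MeasureTheory.Integrable.bdd_mul (c := C) (integrableOn_exp_mul_complex_Ioi h0 0) ?_ ?_
  · exact (Complex.continuous_ofReal.comp continuous_rieszError).aestronglyMeasurable
  · exact .of_forall fun u => by simpa using hb u

open ArithmeticFunction in
lemma integral_rieszError_mul_cexp {w : ℂ} (hw : 0 < w.re) :
    ∫ u : ℝ, (rieszError u : ℂ) * Complex.exp (-w * u) = errorTransform (w + 1) := by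
  obtain ⟨hi, hv⟩ := integral_max_sq_mul_cexp hw
  have hs : 1 < (w + 1).re := by simp; linarith
  have hw0 : w ≠ 0 := by rintro rfl; simp at hw
  have hw1 : w + 1 ≠ 0 := by
    intro h; have := congrArg Complex.re h; simp at this; linarith
  have hw2 : w + 2 ≠ 0 := by
    intro h; have := congrArg Complex.re h; simp at this; linarith
  have h1 : ∫ u : ℝ, (rieszError u : ℂ) * Complex.exp (-w * u) =
      (∫ u : ℝ, ((∑' n : ℕ, Λ n * rieszKernel n u : ℝ) : ℂ) * Complex.exp (-w * u)) -
        ∫ u : ℝ, ((max 0 (1 - Real.exp (-u)) ^ 2 / 2 : ℝ) : ℂ) * Complex.exp (-w * u) := by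
    rw [← MeasureTheory.integral_sub _ hi]
    · congr 1
      ext u
      rw [rieszError]
      push_cast
      ring
    · have := (integrable_rieszError_mul_cexp hw).add hi
      refine this.congr (.of_forall fun u => ?_)
      simp only [Pi.add_apply, rieszError]
      push_cast
      ring
  rw [h1, hv, hasSum_vonMangoldt_rieszKernel hw, LSeries_vonMangoldt_eq_deriv_riemannZeta_div hs,
    errorTransform]
  have hne : w + 1 ≠ 1 := by simpa using hw0
  have hZ := riemannZeta₁_ne_zero_of_one_le_re hs.le
  rw [deriv_riemannZeta_eq_neg_inv_sub_sq_mul_add hne, riemannZeta_eq_inv_sub_mul hne,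
    show w + 1 - 1 = w by ring, show w + 1 + 1 = w + 2 by ring]
  field_simp
  ring

lemma differentiableAt_iteratedDeriv_errorTransform (k : ℕ) {s : ℂ} (hs : 1 < s.re) :
    DifferentiableAt ℂ (iteratedDeriv k errorTransform) s := by
  have ho : IsOpen {s : ℂ | 1 < s.re} := isOpen_lt continuous_const Complex.continuous_re
  have hd : DifferentiableOn ℂ errorTransform {s : ℂ | 1 < s.re} := fun z hz =>
    (differentiableAt_errorTransform (lt_trans one_pos hz)
      (riemannZeta₁_ne_zero_of_one_le_re (le_of_lt hz))).differentiableWithinAt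
  have := (hd.analyticOnNhd ho).iterated_deriv k
  rw [iteratedDeriv_eq_iterate]
  exact (this s hs).differentiableAt

lemma iteratedDeriv_errorTransform_comp (k : ℕ) {a : ℝ} (ha : 1 < a) (x : ℝ) :
    iteratedDeriv k (fun t : ℝ => errorTransform (a + 2 * Real.pi * Complex.I * t)) x =
      (2 * Real.pi * Complex.I) ^ k *
        iteratedDeriv k errorTransform (a + 2 * Real.pi * Complex.I * x) := by
  induction k generalizing x with
  | zero => simp
  | succ k ih =>
    rw [iteratedDeriv_succ, iteratedDeriv_succ, funext ih]
    have hre : 1 < ((a : ℂ) + 2 * Real.pi * Complex.I * x).re := by simpa using ha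
    have h1 := (differentiableAt_iteratedDeriv_errorTransform k hre).hasDerivAt
    have h2 : HasDerivAt (fun t : ℝ => (a : ℂ) + 2 * Real.pi * Complex.I * t)
        (2 * Real.pi * Complex.I * 1) x :=
      ((Complex.ofRealCLM.hasDerivAt (x := x)).const_mul (2 * Real.pi * Complex.I)).const_add _
    have h3 := (h1.comp x h2).const_mul ((2 * Real.pi * Complex.I) ^ k)
    rw [mul_one] at h3
    refine Eq.trans h3.deriv ?_
    ring

lemma integrable_pow_mul_rieszError (k : ℕ) {δ : ℝ} (hδ : 0 < δ) :
    MeasureTheory.Integrable fun u : ℝ =>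
      u ^ k • ((rieszError u : ℂ) * Complex.exp (-(δ : ℂ) * u)) := by
  have hw : 0 < ((δ / 2 : ℝ) : ℂ).re := by simpa using half_pos hδ
  have h := integrable_rieszError_mul_cexp hw
  have h2 := MeasureTheory.Integrable.bdd_mul (c := k.factorial * (2 / δ) ^ k) h
    (f := fun u : ℝ => (((max 0 u) ^ k * Real.exp (-(δ / 2 * max 0 u)) : ℝ) : ℂ))
    (by
      refine Continuous.aestronglyMeasurable ?_
      fun_prop) (.of_forall fun u => ?_)
  · refine h2.congr (.of_forall fun u => ?_)
    rcases le_or_gt u 0 with hu | hu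
    · simp [rieszError_of_nonpos hu]
    · simp only [max_eq_right hu.le]
      rw [Complex.real_smul]
      push_cast
      rw [show -(δ : ℂ) * u = -(δ / 2 * u) + -(δ / 2) * u by ring, Complex.exp_add]
      ring
  · have hv : 0 ≤ max 0 u := le_max_left _ _
    generalize max 0 u = v at hv
    rw [Complex.norm_real, Real.norm_of_nonneg (by positivity), Real.exp_neg, ← div_eq_mul_inv,
      div_le_iff₀ (Real.exp_pos _)]
    have := Real.pow_div_factorial_le_exp (δ / 2 * v) (by positivity) k
    rw [div_le_iff₀ (by positivity)] at this
    calc v ^ k = (2 / δ) ^ k * (δ / 2 * v) ^ k := by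
          rw [← mul_pow]; congr 1; field_simp
      _ ≤ (2 / δ) ^ k * (Real.exp (δ / 2 * v) * k.factorial) := by gcongr
      _ = _ := by ring

open FourierTransform in
lemma fourier_pow_mul_rieszError (k : ℕ) {δ : ℝ} (hδ : 0 < δ) (t : ℝ) :
    𝓕 (fun u : ℝ => (-2 * Real.pi * Complex.I * u) ^ k •
      ((rieszError u : ℂ) * Complex.exp (-(δ : ℂ) * u))) t =
    (2 * Real.pi * Complex.I) ^ k *
      iteratedDeriv k errorTransform ((1 + δ : ℝ) + 2 * Real.pi * Complex.I * t) := by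
  have h1 : 𝓕 (fun u : ℝ => (rieszError u : ℂ) * Complex.exp (-(δ : ℂ) * u)) =
      fun t : ℝ => errorTransform ((1 + δ : ℝ) + 2 * Real.pi * Complex.I * t) := by
    ext t
    rw [Real.fourier_real_eq_integral_exp_smul]
    have hw : 0 < ((δ : ℂ) + 2 * Real.pi * Complex.I * t).re := by simpa using hδ
    have := integral_rieszError_mul_cexp hw
    rw [show ((1 + δ : ℝ) : ℂ) + 2 * Real.pi * Complex.I * t =
      (δ : ℂ) + 2 * Real.pi * Complex.I * t + 1 by push_cast; ring, ← this]
    congr 1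
    ext u
    rw [smul_eq_mul, mul_left_comm, ← Complex.exp_add]
    congr 2
    push_cast
    ring
  rw [← iteratedDeriv_errorTransform_comp k (by linarith), ← h1]
  exact (congrFun (Real.iteratedDeriv_fourier (N := ⊤)
    (fun n _ => integrable_pow_mul_rieszError n hδ) le_top) t).symm

open FourierTransform in
lemma pow_mul_rieszError_bounded (k : ℕ) : ∃ C : ℝ, 0 < C ∧ ∀ u, |u| ^ k * |rieszError u| ≤ C := by
  obtain ⟨C, hC, hb⟩ := norm_iteratedDeriv_errorTransform_le k
  set B : ℝ → ℝ := fun t => (2 * Real.pi) ^ k * (C * (1 + ‖t‖) ^ (-(3 / 2) : ℝ))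
  have hB : MeasureTheory.Integrable B := by
    refine ((integrable_one_add_norm (E := ℝ) (r := 3 / 2) ?_).const_mul C).const_mul _
    simp; norm_num
  set K : ℝ := ∫ t, B t
  have hK : 0 ≤ K := MeasureTheory.integral_nonneg fun t => by simp only [B, Pi.zero_apply]; positivity
  have key : ∀ δ : ℝ, 0 < δ → δ ≤ 1 / 2 → ∀ u : ℝ,
      (2 * Real.pi * |u|) ^ k * (|rieszError u| * Real.exp (-δ * u)) ≤ K := by
    intro δ hδ hδ' u
    set g : ℝ → ℂ := fun u : ℝ => (-2 * Real.pi * Complex.I * u) ^ k •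
      ((rieszError u : ℂ) * Complex.exp (-(δ : ℂ) * u)) with hg
    have hgc : Continuous g := by
      have := continuous_rieszError
      simp only [hg, smul_eq_mul]
      fun_prop
    have hgi : MeasureTheory.Integrable g := by
      refine ((integrable_pow_mul_rieszError k hδ).const_mul
        ((-2 * Real.pi * Complex.I) ^ k)).congr (.of_forall fun u => ?_)
      simp only [hg, smul_eq_mul, Complex.real_smul]
      push_cast
      ring
    have hF := fourier_pow_mul_rieszError k hδ
    rw [← hg] at hF
    have hFc : Continuous (𝓕 g) := by
      rw [show 𝓕 g = _ from funext hF]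
      refine continuous_const.mul (continuous_iff_continuousAt.2 fun t => ?_)
      refine ContinuousAt.comp (f := fun t : ℝ => ((1 + δ : ℝ) : ℂ) + 2 * Real.pi * Complex.I * t)
        (differentiableAt_iteratedDeriv_errorTransform k ?_).continuousAt ?_
      · simpa using hδ
      · exact Continuous.continuousAt (by fun_prop)
    have hFb : ∀ t, ‖𝓕 g t‖ ≤ B t := by
      intro t
      rw [hF, norm_mul, norm_pow]
      have e1 : ‖2 * (Real.pi : ℂ) * Complex.I‖ = 2 * Real.pi := by
        simp [abs_of_pos Real.pi_pos]
      rw [e1]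
      have e2 := hb (((1 + δ : ℝ) : ℂ) + 2 * Real.pi * Complex.I * t) (by simpa using hδ.le)
        (by simp; linarith)
      simp only [B]
      refine mul_le_mul_of_nonneg_left (e2.trans ?_) (by positivity)
      refine mul_le_mul_of_nonneg_left ?_ hC.le
      refine Real.rpow_le_rpow_of_nonpos (by positivity) ?_ (by norm_num)
      have e3 : (((1 + δ : ℝ) : ℂ) + 2 * Real.pi * Complex.I * t).im = 2 * Real.pi * t := by simp
      rw [e3, abs_mul, abs_of_pos (by positivity : 0 < 2 * Real.pi), Real.norm_eq_abs]
      have := Real.pi_gt_three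
      nlinarith [abs_nonneg t]
    have hFi : MeasureTheory.Integrable (𝓕 g) :=
      hB.mono' hFc.aestronglyMeasurable (.of_forall hFb)
    have hinv := congrFun (hgc.fourierInv_fourier_eq hgi hFi) u
    have h1 : ‖g u‖ ≤ K := by
      rw [← hinv, Real.fourierInv_eq']
      refine (MeasureTheory.norm_integral_le_integral_norm _).trans ?_
      refine MeasureTheory.integral_mono_of_nonneg (.of_forall fun t => norm_nonneg _) hB
        (.of_forall fun t => ?_)
      simp only [norm_smul, Complex.norm_exp_ofReal_mul_I, one_mul]
      exact hFb t
    refine le_trans (le_of_eq ?_) h1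
    simp only [hg, norm_smul, norm_mul, norm_pow, Complex.norm_exp]
    simp [abs_of_pos Real.pi_pos]
  refine ⟨K * Real.exp 1 + 1, by positivity, fun u => ?_⟩
  rcases le_or_gt u 0 with hu | hu
  · rw [rieszError_of_nonpos hu]; simp; positivity
  have h := key (1 / (2 * (u + 1))) (by positivity)
    (by rw [div_le_div_iff₀ (by positivity) (by norm_num)]; linarith) u
  have h2 : Real.exp (-1) ≤ Real.exp (-(1 / (2 * (u + 1))) * u) := by
    apply Real.exp_le_exp.2
    rw [neg_mul, neg_le_neg_iff, one_div_mul_eq_div, div_le_one (by positivity)]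
    linarith
  have h3 : |u| ^ k ≤ (2 * Real.pi * |u|) ^ k := by
    refine pow_le_pow_left₀ (abs_nonneg u) ?_ k
    have := Real.pi_gt_three
    nlinarith [abs_nonneg u]
  have h4 : |u| ^ k * |rieszError u| * Real.exp (-1) ≤ K := by
    refine le_trans ?_ h
    rw [mul_assoc]
    gcongr
  rw [Real.exp_neg, ← div_eq_mul_inv, div_le_iff₀ (Real.exp_pos 1)] at h4
  linarith

open ArithmeticFunction in
/-- The Riesz mean `∑_{n ≤ x} Λ(n) (x - n)`. -/
noncomputable def rieszPsi (x : ℝ) : ℝ :=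
  ∑ n ∈ Finset.Ioc 0 ⌊x⌋₊, Λ n * (x - n)

open ArithmeticFunction in
lemma rieszPsi_sub_rieszPsi_bounds {x y : ℝ} (hx : 0 ≤ x) (hxy : x ≤ y) :
    Chebyshev.psi x * (y - x) ≤ rieszPsi y - rieszPsi x ∧
      rieszPsi y - rieszPsi x ≤ Chebyshev.psi y * (y - x) := by
  have hf : ⌊x⌋₊ ≤ ⌊y⌋₊ := Nat.floor_le_floor hxy
  have hψ : Chebyshev.psi y = Chebyshev.psi x + ∑ n ∈ Finset.Ioc ⌊x⌋₊ ⌊y⌋₊, Λ n := by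
    rw [Chebyshev.psi, Chebyshev.psi, Finset.sum_Ioc_consecutive _ (Nat.zero_le _) hf]
  have h : rieszPsi y - rieszPsi x = Chebyshev.psi x * (y - x) +
      ∑ n ∈ Finset.Ioc ⌊x⌋₊ ⌊y⌋₊, Λ n * (y - n) := by
    rw [rieszPsi, rieszPsi, ← Finset.sum_Ioc_consecutive _ (Nat.zero_le _) hf, Chebyshev.psi,
      Finset.sum_mul, add_sub_right_comm, ← Finset.sum_sub_distrib]
    congr 1
    exact Finset.sum_congr rfl fun n _ => by ring
  rw [h, hψ]
  have hy : 0 ≤ y := hx.trans hxy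
  constructor
  · have : 0 ≤ ∑ n ∈ Finset.Ioc ⌊x⌋₊ ⌊y⌋₊, Λ n * (y - n) := by
      refine Finset.sum_nonneg fun n hn => mul_nonneg vonMangoldt_nonneg ?_
      have := (Nat.le_floor_iff hy).1 (Finset.mem_Ioc.1 hn).2
      linarith
    linarith
  · have : ∑ n ∈ Finset.Ioc ⌊x⌋₊ ⌊y⌋₊, Λ n * (y - n) ≤
        ∑ n ∈ Finset.Ioc ⌊x⌋₊ ⌊y⌋₊, Λ n * (y - x) := by
      refine Finset.sum_le_sum fun n hn => mul_le_mul_of_nonneg_left ?_ vonMangoldt_nonneg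
      have := (Nat.floor_lt hx).1 (Finset.mem_Ioc.1 hn).1
      linarith
    rw [← Finset.sum_mul] at this
    linarith

open ArithmeticFunction in
lemma rieszError_log {x : ℝ} (hx : 1 ≤ x) :
    x ^ 2 * rieszError (Real.log x) = rieszPsi x - (x - 1) ^ 2 / 2 := by
  have hx0 : 0 < x := by linarith
  have hexp : Real.exp (Real.log x) = x := Real.exp_log hx0
  have hexp' : Real.exp (-Real.log x) = x⁻¹ := by rw [Real.exp_neg, hexp]
  have hexp2 : Real.exp (-(2 * Real.log x)) = x⁻¹ ^ 2 := by
    rw [show -(2 * Real.log x) = -Real.log x + -Real.log x by ring, Real.exp_add, hexp', sq]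
  rw [rieszError, tsum_rieszKernel_eq_sum (N := ⌊x⌋₊) (by rw [hexp]; exact (Nat.lt_floor_add_one _).le),
    hexp', max_eq_right (sub_nonneg.2 (inv_le_one_of_one_le₀ hx)), mul_sub, Finset.mul_sum, rieszPsi]
  congr 1
  · refine Finset.sum_congr rfl fun n hn => ?_
    rw [rieszKernel_of_le, hexp', hexp2]
    · field_simp
    · rw [hexp]
      exact (Nat.le_floor_iff hx0.le).1 (Finset.mem_Ioc.1 hn).2
  · field_simp

lemma abs_rieszPsi_sub_le (k : ℕ) : ∃ C : ℝ, 0 < C ∧ ∀ x : ℝ, 1 < x →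
    |rieszPsi x - (x - 1) ^ 2 / 2| ≤ C * x ^ 2 / Real.log x ^ k := by
  obtain ⟨C, hC, h⟩ := pow_mul_rieszError_bounded k
  refine ⟨C, hC, fun x hx => ?_⟩
  have hl : 0 < Real.log x := Real.log_pos hx
  rw [← rieszError_log hx.le, abs_mul, abs_of_pos (by positivity), le_div_iff₀ (by positivity)]
  have := h (Real.log x)
  rw [abs_of_pos hl] at this
  nlinarith [sq_nonneg x]

lemma eventually_log_pow_le (k : ℕ) : ∀ᶠ x : ℝ in Filter.atTop, Real.log x ^ k ≤ x := by
  filter_upwards [(Real.isLittleO_pow_log_id_atTop (n := k)).bound one_pos, Filter.eventually_ge_atTop 1]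
    with x hx h1
  have := Real.log_nonneg h1
  rw [one_mul, Real.norm_of_nonneg (by positivity), id, Real.norm_of_nonneg (by linarith)] at hx
  exact hx

/-- The prime number theorem for `ψ` with an error term saving any power of `log x`. -/
lemma abs_psi_sub_le {A : ℕ} (hA : 1 ≤ A) : ∃ C : ℝ, 0 < C ∧ ∀ᶠ x : ℝ in Filter.atTop,
    |Chebyshev.psi x - x| ≤ C * x / Real.log x ^ A := by
  obtain ⟨C, hC, h⟩ := abs_rieszPsi_sub_le (2 * A)
  refine ⟨2 + 5 * C + C * (1 + 4 ^ A), by positivity, ?_⟩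
  filter_upwards [eventually_log_pow_le A, Filter.eventually_ge_atTop 4,
    Real.tendsto_log_atTop.eventually_ge_atTop 2] with x h1 h4 hl
  have hx0 : 0 < x := by linarith
  have hl0 : 0 < Real.log x := by linarith
  set P := Real.log x ^ A with hP
  have hP2 : 2 ≤ P := hl.trans (le_self_pow₀ (by linarith) (by omega))
  have hP0 : 0 < P := by linarith
  set lam := P⁻¹ with hlam
  have hlP : lam * P = 1 := inv_mul_cancel₀ hP0.ne'
  have hlam0 : 0 < lam := inv_pos.2 hP0
  have hlam2 : lam ≤ 1 / 2 := by rw [hlam, inv_le_comm₀ hP0 (by norm_num)]; norm_num; exact hP2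
  have hone : 1 ≤ x * lam := by nlinarith
  have hsq : Real.log x ^ (2 * A) = P ^ 2 := by rw [hP, ← pow_mul, mul_comm]
  have hdiv (a : ℝ) : a / P = a * lam := div_eq_mul_inv _ _
  have hdiv2 (a : ℝ) : a / P ^ 2 = a * lam ^ 2 := by rw [hlam, inv_pow, div_eq_mul_inv]
  have hEx := h x (by linarith)
  rw [hsq, hdiv2, abs_le] at hEx
  rw [hdiv, abs_le]
  have hδ : 0 < x * lam := by positivity
  constructor
  · set y := x - x * lam with hy
    have hyx : y ≤ x := by linarith
    have hy2 : x / 2 ≤ y := by nlinarith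
    have hyl : Real.log x / 2 ≤ Real.log y := by
      have h5 : x ≤ y ^ 2 := by nlinarith
      have h6 := Real.log_le_log hx0 h5
      rw [Real.log_pow] at h6
      push_cast at h6
      linarith
    have hEy := h y (by linarith)
    have hy0 : 0 ≤ y := by linarith
    have hEy2 : C * y ^ 2 / Real.log y ^ (2 * A) ≤ C * 4 ^ A * x ^ 2 * lam ^ 2 := by
      calc C * y ^ 2 / Real.log y ^ (2 * A) ≤ C * x ^ 2 / (Real.log x / 2) ^ (2 * A) := by
            gcongr
        _ = _ := by
            rw [div_pow, hsq, hlam, pow_mul]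
            field_simp
            norm_num
    rw [abs_le] at hEy
    have hb := (rieszPsi_sub_rieszPsi_bounds hy0 hyx).2
    have hxy : x - y = x * lam := by rw [hy]; ring
    have h7 : (x - 1) ^ 2 / 2 - (y - 1) ^ 2 / 2 = (x * lam) * (x - x * lam / 2 - 1) := by
      rw [hy]; ring
    have h8 : (x * lam) * (x - x * lam / 2 - 1 - C * (1 + 4 ^ A) * (x * lam)) ≤
        (x * lam) * Chebyshev.psi x := by
      rw [hxy] at hb
      nlinarith
    have h9 := le_of_mul_le_mul_left h8 hδ
    nlinarith
  · set y := x + x * lam with hy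
    have hyx : x ≤ y := by linarith
    have hy2 : y ≤ 2 * x := by nlinarith
    have hEy := h y (by linarith)
    have hEy2 : C * y ^ 2 / Real.log y ^ (2 * A) ≤ 4 * C * x ^ 2 * lam ^ 2 := by
      calc C * y ^ 2 / Real.log y ^ (2 * A) ≤ C * (2 * x) ^ 2 / Real.log x ^ (2 * A) := by
            gcongr
        _ = _ := by rw [hsq, hdiv2]; ring
    rw [abs_le] at hEy
    have hb := (rieszPsi_sub_rieszPsi_bounds hx0.le hyx).1
    have hxy : y - x = x * lam := by rw [hy]; ring
    have h7 : (y - 1) ^ 2 / 2 - (x - 1) ^ 2 / 2 = (x * lam) * (x + x * lam / 2 - 1) := by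
      rw [hy]; ring
    have h8 : (x * lam) * Chebyshev.psi x ≤
        (x * lam) * (x + x * lam / 2 - 1 + 5 * C * (x * lam)) := by
      rw [hxy] at hb
      nlinarith
    have h9 := le_of_mul_le_mul_left h8 hδ
    have h10 : 0 ≤ C * (1 + 4 ^ A) * (x * lam) := by positivity
    nlinarith

/-- The prime number theorem for `θ` with an error term saving any power of `log x`. -/
lemma abs_theta_sub_le {A : ℕ} (hA : 1 ≤ A) : ∃ C : ℝ, 0 < C ∧ ∀ᶠ x : ℝ in Filter.atTop,
    |Chebyshev.theta x - x| ≤ C * x / Real.log x ^ A := by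
  obtain ⟨C, hC, h⟩ := abs_psi_sub_le hA
  obtain ⟨K, hK⟩ := Chebyshev.psi_sub_theta_le_mul_sqrt
  refine ⟨C + |K|, by positivity, ?_⟩
  filter_upwards [h, eventually_log_pow_le (2 * A), Filter.eventually_ge_atTop 4] with x hx h1 h4
  have hl0 : 0 < Real.log x := Real.log_pos (by linarith)
  have h2 := hK x
  have h3 := Chebyshev.theta_le_psi x
  have h5 : Real.log x ^ A ≤ √x := by
    apply Real.le_sqrt_of_sq_le
    rw [← pow_mul, mul_comm]
    exact h1
  have h6 : √x ≤ x / Real.log x ^ A := by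
    rw [le_div_iff₀ (by positivity)]
    calc √x * Real.log x ^ A ≤ √x * √x := by gcongr
      _ = x := Real.mul_self_sqrt (by linarith)
  have h7 : K * √x ≤ |K| * (x / Real.log x ^ A) :=
    (mul_le_mul_of_nonneg_right (le_abs_self K) (Real.sqrt_nonneg x)).trans (by gcongr)
  have h8 : 0 ≤ |K| * (x / Real.log x ^ A) := by
    have : 0 < x := by linarith
    positivity
  rw [add_mul, add_div, mul_div_assoc |K|]
  rw [abs_le] at hx ⊢
  constructor <;> linarith

/-- The value `∏_{p ∈ s} (1 - 1/p)` of `φ(d)/d` when `s` is the set of prime factors of `d`. -/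
noncomputable def totientRatio (s : Finset ℕ) : ℝ :=
  ∏ p ∈ s, (1 - (p : ℝ)⁻¹)

lemma totient_eq_mul_totientRatio (d : ℕ) :
    (Nat.totient d : ℝ) = d * totientRatio d.primeFactors := by
  have := congrArg (fun q : ℚ => (q : ℝ)) (Nat.totient_eq_mul_prod_factors d)
  push_cast at this
  exact this

lemma totientRatio_nonneg (s : Finset ℕ) : 0 ≤ totientRatio s :=
  Finset.prod_nonneg fun p _ => sub_nonneg.2 (Nat.cast_inv_le_one p)

lemma totientRatio_le_one (s : Finset ℕ) : totientRatio s ≤ 1 :=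
  Finset.prod_le_one (fun p _ => sub_nonneg.2 (Nat.cast_inv_le_one p))
    fun p _ => sub_le_self _ (by positivity)

lemma totientRatio_mul_prod {s : Finset ℕ} (hs : ∀ p ∈ s, p.Prime) :
    totientRatio s * ((∏ p ∈ s, p : ℕ) : ℝ) = ((∏ p ∈ s, (p - 1) : ℕ) : ℝ) := by
  rw [totientRatio]
  push_cast
  rw [← Finset.prod_mul_distrib]
  refine Finset.prod_congr rfl fun p hp => ?_
  have h1 := (hs p hp).one_le
  have h2 : (p : ℝ) ≠ 0 := by exact_mod_cast (hs p hp).ne_zero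
  rw [Nat.cast_sub h1]
  field_simp
  simp

lemma totientRatio_pos {s : Finset ℕ} (hs : ∀ p ∈ s, p.Prime) : 0 < totientRatio s :=
  Finset.prod_pos fun p hp =>
    sub_pos.2 (inv_lt_one_of_one_lt₀ (by exact_mod_cast (hs p hp).one_lt))

lemma subset_of_totientRatio_eq_aux {s t : Finset ℕ} (hs : ∀ p ∈ s, p.Prime)
    (ht : ∀ p ∈ t, p.Prime) (hst : Disjoint s t) (h : totientRatio s = totientRatio t)
    {q : ℕ} (hq : q ∈ s) (hmax : ∀ p ∈ s, p ≤ q) : False := by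
  have h1 := totientRatio_mul_prod hs
  have h2 := totientRatio_mul_prod ht
  have h3 : (∏ p ∈ s, (p - 1)) * (∏ p ∈ t, p) = (∏ p ∈ t, (p - 1)) * ∏ p ∈ s, p := by
    have : (((∏ p ∈ s, (p - 1)) * (∏ p ∈ t, p) : ℕ) : ℝ) =
        (((∏ p ∈ t, (p - 1)) * ∏ p ∈ s, p : ℕ) : ℝ) := by
      rw [Nat.cast_mul, Nat.cast_mul, ← h1, ← h2, h]; ring
    exact_mod_cast this
  have hqp := hs q hq
  have h4 : q ∣ (∏ p ∈ s, (p - 1)) * (∏ p ∈ t, p) := by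
    rw [h3]
    exact (Finset.dvd_prod_of_mem _ hq).mul_left _
  rcases hqp.dvd_mul.1 h4 with h5 | h5
  · obtain ⟨p, hp, h6⟩ := (Prime.dvd_finsetProd_iff hqp.prime _).1 h5
    have := Nat.le_of_dvd (by have := (hs p hp).two_le; omega) h6
    have := hmax p hp
    have := (hs p hp).two_le
    omega
  · obtain ⟨p, hp, h6⟩ := (Prime.dvd_finsetProd_iff hqp.prime _).1 h5
    have : q = p := (Nat.prime_dvd_prime_iff_eq hqp (ht p hp)).1 h6
    exact Finset.disjoint_left.1 hst hq (this ▸ hp)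

lemma eq_of_totientRatio_eq {s t : Finset ℕ} (hs : ∀ p ∈ s, p.Prime)
    (ht : ∀ p ∈ t, p.Prime) (h : totientRatio s = totientRatio t) : s = t := by
  have hs' : ∀ p ∈ s \ t, p.Prime := fun p hp => hs p (Finset.sdiff_subset hp)
  have ht' : ∀ p ∈ t \ s, p.Prime := fun p hp => ht p (Finset.sdiff_subset hp)
  have hd : Disjoint (s \ t) (t \ s) := disjoint_sdiff_sdiff
  have h' : totientRatio (s \ t) = totientRatio (t \ s) := by
    have h1 : totientRatio (s ∩ t) * totientRatio (s \ t) = totientRatio s :=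
      Finset.prod_inter_mul_prod_sdiff s t _
    have h2 : totientRatio (s ∩ t) * totientRatio (t \ s) = totientRatio t := by
      rw [Finset.inter_comm]; exact Finset.prod_inter_mul_prod_sdiff t s _
    have h3 : totientRatio (s ∩ t) ≠ 0 :=
      (totientRatio_pos fun p hp => hs p (Finset.inter_subset_left hp)).ne'
    exact mul_left_cancel₀ h3 (by rw [h1, h2, h])
  by_contra hne
  have hnon : ((s \ t) ∪ (t \ s)).Nonempty := by
    rw [Finset.nonempty_iff_ne_empty]
    intro h0
    rw [Finset.union_eq_empty, Finset.sdiff_eq_empty_iff_subset,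
      Finset.sdiff_eq_empty_iff_subset] at h0
    exact hne (h0.1.antisymm h0.2)
  obtain ⟨q, hq, hmax⟩ := Finset.exists_max_image _ id hnon
  have hm1 : ∀ p ∈ s \ t, p ≤ q := fun p hp => hmax p (Finset.mem_union_left _ hp)
  have hm2 : ∀ p ∈ t \ s, p ≤ q := fun p hp => hmax p (Finset.mem_union_right _ hp)
  rcases Finset.mem_union.1 hq with hq | hq
  · exact subset_of_totientRatio_eq_aux hs' ht' hd h' hq hm1
  · exact subset_of_totientRatio_eq_aux ht' hs' hd.symm h'.symm hq hm2

lemma totientRatio_add_le {s t : Finset ℕ} (hs : ∀ p ∈ s, p.Prime) (ht : ∀ p ∈ t, p.Prime)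
    {R : ℕ} (hsR : ∏ p ∈ s, p ≤ R) (htR : ∏ p ∈ t, p ≤ R)
    (h : totientRatio t < totientRatio s) : totientRatio t + 1 / (R : ℝ) ^ 2 ≤ totientRatio s := by
  have h1 := totientRatio_mul_prod hs
  have h2 := totientRatio_mul_prod ht
  have hs0 : 0 < ∏ p ∈ s, p := Finset.prod_pos fun p hp => (hs p hp).pos
  have ht0 : 0 < ∏ p ∈ t, p := Finset.prod_pos fun p hp => (ht p hp).pos
  set a := ∏ p ∈ s, p
  set b := ∏ p ∈ t, p
  set a' := ∏ p ∈ s, (p - 1)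
  set b' := ∏ p ∈ t, (p - 1)
  have hs0' : (0 : ℝ) < a := by exact_mod_cast hs0
  have ht0' : (0 : ℝ) < b := by exact_mod_cast ht0
  have h3 : ((b' * a : ℕ) : ℝ) < ((a' * b : ℕ) : ℝ) := by
    rw [Nat.cast_mul, Nat.cast_mul, ← h1, ← h2]
    have : 0 < (a : ℝ) * b := by positivity
    nlinarith
  have h4 : ((b' * a : ℕ) : ℝ) + 1 ≤ ((a' * b : ℕ) : ℝ) := by
    have : b' * a < a' * b := by exact_mod_cast h3
    exact_mod_cast this
  rw [Nat.cast_mul, Nat.cast_mul, ← h1, ← h2] at h4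
  have h5 : totientRatio t + 1 / ((a : ℝ) * b) ≤ totientRatio s := by
    rw [← le_sub_iff_add_le', div_le_iff₀ (by positivity)]
    nlinarith
  refine le_trans ?_ h5
  have : (a : ℝ) * b ≤ (R : ℝ) ^ 2 := by
    rw [sq]
    have : (a : ℝ) ≤ R := by exact_mod_cast hsR
    have : (b : ℝ) ≤ R := by exact_mod_cast htR
    gcongr
  gcongr

lemma totientRatio_le_of_totient_le {d p d' p' R : ℕ} (hp : p.Prime) (hp' : p'.Prime)
    (hpd : ¬ p ∣ d) (hd : 0 < d)
    (hR : ∏ q ∈ d.primeFactors, q ≤ R) (hR' : ∏ q ∈ d'.primeFactors, q ≤ R)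
    (hpR : 2 * R ^ 2 ≤ p) (hle : d * p ≤ d' * p') (hclose : 2 * R ^ 2 * (d' * p' - d * p) < d * p)
    (hφ : Nat.totient (d * p) ≤ Nat.totient (d' * p')) :
    totientRatio d.primeFactors ≤ totientRatio d'.primeFactors := by
  by_contra! hlt
  have hs : ∀ q ∈ d.primeFactors, q.Prime := fun q hq => Nat.prime_of_mem_primeFactors hq
  have hs' : ∀ q ∈ d'.primeFactors, q.Prime := fun q hq => Nat.prime_of_mem_primeFactors hq
  have hgap := totientRatio_add_le hs hs' hR hR' hlt
  have hR0 : 0 < R := lt_of_lt_of_le (Finset.prod_pos fun p hp => (hs p hp).pos) hR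
  set a := totientRatio d.primeFactors
  set b := totientRatio d'.primeFactors
  have ha1 : a ≤ 1 := totientRatio_le_one _
  have hb0 : 0 ≤ b := totientRatio_nonneg _
  have hb1 : b ≤ 1 := totientRatio_le_one _
  have h1 : (Nat.totient (d * p) : ℝ) = a * (d * p) - a * d := by
    rw [Nat.totient_mul ((Nat.Prime.coprime_iff_not_dvd hp).2 hpd).symm, Nat.totient_prime hp,
      Nat.cast_mul, totient_eq_mul_totientRatio, Nat.cast_sub hp.one_le]
    push_cast
    ring
  have h2 : (Nat.totient (d' * p') : ℝ) ≤ b * (d' * p') := by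
    have h3 : Nat.totient (d' * p') ≤ Nat.totient d' * p' := by
      by_cases h : p' ∣ d'
      · rw [mul_comm, Nat.totient_mul_of_prime_of_dvd hp' h, mul_comm]
      · rw [Nat.totient_mul ((Nat.Prime.coprime_iff_not_dvd hp').2 h).symm, Nat.totient_prime hp']
        exact Nat.mul_le_mul_left _ (Nat.sub_le _ _)
    calc (Nat.totient (d' * p') : ℝ) ≤ ((Nat.totient d' * p' : ℕ) : ℝ) := by exact_mod_cast h3
      _ = _ := by rw [Nat.cast_mul, totient_eq_mul_totientRatio]; ring
  have h3 : a * (d * p) - a * d ≤ b * (d' * p') := by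
    rw [← h1]
    exact le_trans (by exact_mod_cast hφ) h2
  have hR2 : (0 : ℝ) < (R : ℝ) ^ 2 := by positivity
  have hcl : 2 * (R : ℝ) ^ 2 * (d' * p' - d * p) < d * p := by
    have : ((2 * R ^ 2 * (d' * p' - d * p) : ℕ) : ℝ) < ((d * p : ℕ) : ℝ) := by exact_mod_cast hclose
    rw [Nat.cast_mul, Nat.cast_sub hle] at this
    push_cast at this
    exact this
  have hpR' : 2 * (R : ℝ) ^ 2 ≤ p := by exact_mod_cast hpR
  have hle' : (d : ℝ) * p ≤ d' * p' := by exact_mod_cast hle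
  have hd' : (0 : ℝ) < d := by exact_mod_cast hd
  have hgap' : b * R ^ 2 + 1 ≤ a * R ^ 2 := by
    have := mul_le_mul_of_nonneg_right hgap hR2.le
    rw [add_mul, div_mul_cancel₀ _ hR2.ne'] at this
    exact this
  set n : ℝ := d * p with hn
  set m : ℝ := d' * p'
  have e1 : 2 * (R : ℝ) ^ 2 * (b * (m - n)) < n := by
    have : b * (m - n) ≤ m - n := mul_le_of_le_one_left (sub_nonneg.2 hle') hb1
    nlinarith
  have e2 : 2 * (R : ℝ) ^ 2 * (a * d) ≤ n := by
    have : a * d ≤ d := by nlinarith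
    nlinarith
  have hn0 : 0 ≤ n := by positivity
  have e3 := mul_le_mul_of_nonneg_right hgap' hn0
  have e4 := mul_le_mul_of_nonneg_left h3 (by positivity : 0 ≤ 2 * (R : ℝ) ^ 2)
  nlinarith

lemma sum_le_prod_of_primeFactors_eq {f : ℕ →* ℝ} (h0 : ∀ n, 0 ≤ f n)
    (h1 : ∀ p : ℕ, p.Prime → f p < 1) {s E : Finset ℕ} (hs : ∀ p ∈ s, p.Prime)
    (hE : ∀ d ∈ E, d ≠ 0 ∧ d.primeFactors = s) :
    ∑ d ∈ E, f d ≤ ∏ p ∈ s, f p * (1 - f p)⁻¹ := by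
  set r := ∏ p ∈ s, p with hr
  have hr0 : 0 < r := Finset.prod_pos fun p hp => (hs p hp).pos
  have hdvd : ∀ d ∈ E, r ∣ d := fun d hd => by
    rw [hr, ← (hE d hd).2]; exact Nat.prod_primeFactors_dvd d
  have hH := (EulerProduct.summable_and_hasSum_factoredNumbers_prod_filter_prime_geometric
    (f := f) (fun {p} hp => by rw [Real.norm_of_nonneg (h0 p)]; exact h1 p hp) s).2
  rw [Finset.filter_true_of_mem hs] at hH
  have hH' : HasSum (Set.indicator (Nat.factoredNumbers s) f) (∏ p ∈ s, (1 - f p)⁻¹) :=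
    hasSum_subtype_iff_indicator.1 hH
  have hinj : Set.InjOn (fun d => d / r) E := by
    intro a ha b hb hab
    rw [← Nat.div_mul_cancel (hdvd a ha), ← Nat.div_mul_cancel (hdvd b hb)]
    exact congrArg (· * r) hab
  have hmem : ∀ d ∈ E, d / r ∈ Nat.factoredNumbers s := fun d hd => by
    refine Nat.mem_factoredNumbers_of_dvd ?_ (Nat.div_dvd_of_dvd (hdvd d hd))
    exact Nat.mem_factoredNumbers_of_primeFactors_subset (hE d hd).1 (hE d hd).2.subset
  calc ∑ d ∈ E, f d = f r * ∑ d ∈ E, Set.indicator (Nat.factoredNumbers s) f (d / r) := by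
        rw [Finset.mul_sum]
        refine Finset.sum_congr rfl fun d hd => ?_
        rw [Set.indicator_of_mem (hmem d hd), ← map_mul, Nat.mul_div_cancel' (hdvd d hd)]
    _ = f r * ∑ m ∈ E.image (fun d => d / r), Set.indicator (Nat.factoredNumbers s) f m := by
        rw [Finset.sum_image hinj]
    _ ≤ f r * ∏ p ∈ s, (1 - f p)⁻¹ := by
        refine mul_le_mul_of_nonneg_left (sum_le_hasSum _ (fun m _ => ?_) hH') (h0 r)
        exact Set.indicator_nonneg (fun m _ => h0 m) m
    _ = _ := by rw [hr, map_prod, Finset.prod_mul_distrib]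

lemma sum_inv_le_one_of_primeFactors_eq {s E : Finset ℕ} (hs : ∀ p ∈ s, p.Prime)
    (hE : ∀ d ∈ E, d ≠ 0 ∧ d.primeFactors = s) : ∑ d ∈ E, (d : ℝ)⁻¹ ≤ 1 := by
  let f : ℕ →* ℝ :=
    { toFun := fun n => (n : ℝ)⁻¹, map_one' := by simp, map_mul' := fun a b => by simp [mul_comm] }
  have hf (n : ℕ) : f n = (n : ℝ)⁻¹ := rfl
  have h := sum_le_prod_of_primeFactors_eq (f := f) (fun n => by rw [hf]; positivity)
    (fun p hp => inv_lt_one_of_one_lt₀ (by exact_mod_cast hp.one_lt)) hs hE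
  simp only [hf] at h
  refine h.trans (Finset.prod_le_one (fun p hp => ?_) fun p hp => ?_)
  · exact mul_nonneg (by positivity) (inv_nonneg.2 (sub_nonneg.2 (Nat.cast_inv_le_one p)))
  · have h2 : (2 : ℝ) ≤ p := by exact_mod_cast (hs p hp).two_le
    have : (p : ℝ)⁻¹ ≤ 1 / 2 := by rw [inv_eq_one_div]; gcongr
    rw [← div_eq_mul_inv, div_le_one (by linarith)]
    linarith

lemma sum_inv_sqrt_le_of_primeFactors_eq {s E : Finset ℕ} (hs : ∀ p ∈ s, p.Prime)
    (hE : ∀ d ∈ E, d ≠ 0 ∧ d.primeFactors = s) : ∑ d ∈ E, (√d)⁻¹ ≤ 4 := by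
  let f : ℕ →* ℝ :=
    { toFun := fun n => (√n)⁻¹, map_one' := by simp, map_mul' := fun a b => by simp [mul_comm] }
  have hf (n : ℕ) : f n = (√n)⁻¹ := rfl
  have hlt : ∀ p : ℕ, p.Prime → (√p)⁻¹ < 1 := fun p hp =>
    inv_lt_one_of_one_lt₀ (Real.lt_sqrt_of_sq_lt (by simpa using hp.one_lt))
  have h := sum_le_prod_of_primeFactors_eq (f := f) (fun n => by rw [hf]; positivity) hlt hs hE
  simp only [hf] at h
  have hstep : ∀ p ∈ s, (√p)⁻¹ * (1 - (√p)⁻¹)⁻¹ ≤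
      (if p = 2 then (5 / 2 : ℝ) else 1) * (if p = 3 then (8 / 5 : ℝ) else 1) := by
    intro p hp
    have h1 := hlt p (hs p hp)
    have hpos : 0 < √(p : ℝ) := Real.sqrt_pos.2 (by exact_mod_cast (hs p hp).pos)
    have h2 : 1 < √(p : ℝ) := by rwa [inv_lt_one₀ hpos] at h1
    have h3 : (√p)⁻¹ * (1 - (√p)⁻¹)⁻¹ = 1 / (√(p : ℝ) - 1) := by
      have : √(p : ℝ) - 1 ≠ 0 := by linarith
      field_simp
    rw [h3, div_le_iff₀ (by linarith)]
    by_cases p2 : p = 2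
    · subst p2
      have : (7 / 5 : ℝ) ≤ √(2 : ℕ) := Real.le_sqrt_of_sq_le (by norm_num)
      norm_num at this ⊢
      linarith
    by_cases p3 : p = 3
    · subst p3
      have : (17 / 10 : ℝ) ≤ √(3 : ℕ) := Real.le_sqrt_of_sq_le (by norm_num)
      norm_num at this ⊢
      linarith
    have h4 : 4 ≤ p := by have := (hs p hp).two_le; omega
    have : (2 : ℝ) ≤ √p := Real.le_sqrt_of_sq_le (by norm_num; exact_mod_cast h4)
    simp only [p2, p3, if_false]
    linarith
  refine h.trans ((Finset.prod_le_prod (fun p hp => ?_) hstep).trans ?_)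
  · exact mul_nonneg (by positivity) (inv_nonneg.2 (sub_nonneg.2 (hlt p (hs p hp)).le))
  · rw [Finset.prod_mul_distrib, Finset.prod_ite_eq', Finset.prod_ite_eq']
    split_ifs <;> norm_num

lemma sum_log_div_le_of_primeFactors_eq {s E : Finset ℕ} (hs : ∀ p ∈ s, p.Prime)
    (hE : ∀ d ∈ E, d ≠ 0 ∧ d.primeFactors = s) : ∑ d ∈ E, Real.log d / d ≤ 8 := by
  calc ∑ d ∈ E, Real.log d / d ≤ ∑ d ∈ E, 2 * (√d)⁻¹ := by
        refine Finset.sum_le_sum fun d hd => ?_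
        have hd0 : (0 : ℝ) < d := by exact_mod_cast Nat.pos_of_ne_zero (hE d hd).1
        have h1 := Real.log_le_sub_one_of_pos (Real.sqrt_pos.2 hd0)
        rw [Real.log_sqrt hd0.le] at h1
        have h2 := Real.mul_self_sqrt hd0.le
        have h3 := Real.sqrt_pos.2 hd0
        rw [div_le_iff₀ hd0]
        calc Real.log d ≤ 2 * √d := by linarith
          _ = 2 * (√d)⁻¹ * (√d * √d) := by field_simp
          _ = _ := by rw [h2]
    _ = 2 * ∑ d ∈ E, (√d)⁻¹ := by rw [Finset.mul_sum]
    _ ≤ 8 := by have := sum_inv_sqrt_le_of_primeFactors_eq hs hE; linarith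

lemma sum_inv_le_of_primeFactors_eq {s E : Finset ℕ} (hs : ∀ p ∈ s, p.Prime)
    (hE : ∀ d ∈ E, d ≠ 0 ∧ d.primeFactors = s) {R : ℕ} (hR : 0 < R) (hRs : R ≤ ∏ p ∈ s, p) :
    ∑ d ∈ E, (d : ℝ)⁻¹ ≤ 4 / √R := by
  have hR' : (0 : ℝ) < R := by exact_mod_cast hR
  calc ∑ d ∈ E, (d : ℝ)⁻¹ ≤ ∑ d ∈ E, (√d)⁻¹ * (√R)⁻¹ := by
        refine Finset.sum_le_sum fun d hd => ?_
        have hRd : R ≤ d := by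
          refine hRs.trans (Nat.le_of_dvd (Nat.pos_of_ne_zero (hE d hd).1) ?_)
          rw [← (hE d hd).2]
          exact Nat.prod_primeFactors_dvd d
        have hRd' : (R : ℝ) ≤ d := by exact_mod_cast hRd
        rw [← mul_inv]
        have h1 := Real.sqrt_pos.2 hR'
        have h2 : √(R : ℝ) ≤ √d := Real.sqrt_le_sqrt hRd'
        have h3 : 0 < √(d : ℝ) := h1.trans_le h2
        refine inv_anti₀ (by positivity) ?_
        nlinarith [Real.mul_self_sqrt (hR'.le.trans hRd')]
    _ = (∑ d ∈ E, (√d)⁻¹) * (√R)⁻¹ := by rw [Finset.sum_mul]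
    _ ≤ 4 * (√R)⁻¹ := by
        gcongr
        exact sum_inv_sqrt_le_of_primeFactors_eq hs hE
    _ = _ := by rw [div_eq_mul_inv]

lemma card_le_of_convex_fibers {β : Type*} [DecidableEq β] {B : Finset ℕ} {f : ℕ → β} {X : ℕ}
    {κ e : ℝ} (hκ : 0 ≤ κ) (hB : ∀ n ∈ B, n ≤ X)
    (hconv : ∀ a ∈ B, ∀ b ∈ B, ∀ c ∈ B, a ≤ b → b ≤ c → f a = f c → f b = f a)
    (hfib : ∀ u ∈ B, ∀ v ∈ B, u ≤ v → f u = f v →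
      (({n ∈ B | f n = f u ∧ u ≤ n ∧ n ≤ v} : Finset ℕ).card : ℝ) ≤ κ * (v - u) + e) :
    (B.card : ℝ) ≤ κ * X + (B.image f).card * e := by
  have hne : ∀ l ∈ B.image f, ({n ∈ B | f n = l} : Finset ℕ).Nonempty := by
    intro l hl
    obtain ⟨n, hn, rfl⟩ := Finset.mem_image.1 hl
    exact ⟨n, by simp [hn]⟩
  choose! lo hlo hlo' using fun l hl => Finset.exists_min_image _ id (hne l hl)
  choose! hi hhi hhi' using fun l hl => Finset.exists_max_image _ id (hne l hl)
  simp only [Finset.mem_filter, id] at hlo hlo' hhi hhi'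
  have hlohi : ∀ l ∈ B.image f, lo l ≤ hi l := fun l hl => hlo' l hl (hi l) (hhi l hl)
  have hdisj : (B.image f : Set β).PairwiseDisjoint fun l => Finset.Ioc (lo l) (hi l) := by
    intro l hl l' hl' hne
    rw [Function.onFun, Finset.disjoint_left]
    intro t ht ht'
    rw [Finset.mem_Ioc] at ht ht'
    rcases le_total (lo l) (lo l') with h | h
    · have := hconv (lo l) (hlo l hl).1 (lo l') (hlo l' hl').1 (hi l) (hhi l hl).1 h
        (by omega) ((hlo l hl).2.trans (hhi l hl).2.symm)
      exact hne ((hlo l hl).2.symm.trans (this.symm.trans (hlo l' hl').2))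
    · have := hconv (lo l') (hlo l' hl').1 (lo l) (hlo l hl).1 (hi l') (hhi l' hl').1 h
        (by omega) ((hlo l' hl').2.trans (hhi l' hl').2.symm)
      exact hne ((hlo l hl).2.symm.trans (this.trans (hlo l' hl').2))
  have hlen : ∑ l ∈ B.image f, ((hi l : ℝ) - lo l) ≤ X := by
    have h1 : ∑ l ∈ B.image f, (hi l - lo l) ≤ X := by
      calc ∑ l ∈ B.image f, (hi l - lo l) = ((B.image f).biUnion
            fun l => Finset.Ioc (lo l) (hi l)).card := by
            rw [Finset.card_biUnion hdisj]; simp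
        _ ≤ (Finset.Ioc 0 X).card := by
            refine Finset.card_le_card fun t ht => ?_
            obtain ⟨l, hl, ht⟩ := Finset.mem_biUnion.1 ht
            have := hB _ (hhi l hl).1
            simp only [Finset.mem_Ioc] at ht ⊢
            omega
        _ = X := by simp
    calc ∑ l ∈ B.image f, ((hi l : ℝ) - lo l) = ((∑ l ∈ B.image f, (hi l - lo l) : ℕ) : ℝ) := by
          rw [Nat.cast_sum]
          exact Finset.sum_congr rfl fun l hl => by rw [Nat.cast_sub (hlohi l hl)]
      _ ≤ X := by exact_mod_cast h1
  have hcard : (B.card : ℝ) = ∑ l ∈ B.image f, (({n ∈ B | f n = l} : Finset ℕ).card : ℝ) := by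
    exact_mod_cast Finset.card_eq_sum_card_image f B
  rw [hcard]
  calc ∑ l ∈ B.image f, (({n ∈ B | f n = l} : Finset ℕ).card : ℝ)
      ≤ ∑ l ∈ B.image f, (κ * ((hi l : ℝ) - lo l) + e) := by
        refine Finset.sum_le_sum fun l hl => ?_
        refine le_trans ?_ (hfib (lo l) (hlo l hl).1 (hi l) (hhi l hl).1 (hlohi l hl)
          ((hlo l hl).2.trans (hhi l hl).2.symm))
        rw [Nat.cast_le]
        refine Finset.card_le_card fun n hn => ?_
        rw [Finset.mem_filter] at hn ⊢
        exact ⟨hn.1, hn.2.trans (hlo l hl).2.symm, hlo' l hl n hn, hhi' l hl n hn⟩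
    _ = κ * ∑ l ∈ B.image f, ((hi l : ℝ) - lo l) + (B.image f).card * e := by
        rw [Finset.sum_add_distrib, ← Finset.mul_sum, Finset.sum_const, nsmul_eq_mul]
    _ ≤ _ := by gcongr

open Classical in
lemma card_le_of_totient_monotone {B : Finset ℕ} {d p : ℕ → ℕ} {X R w : ℕ} {κ e : ℝ}
    (hκ : 0 ≤ κ) (he : 0 ≤ e) (hw : 0 < w) (hX : ∀ n ∈ B, n ≤ X)
    (hdp : ∀ n ∈ B, n = d n * p n) (hp : ∀ n ∈ B, (p n).Prime) (hd : ∀ n ∈ B, 0 < d n)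
    (hpd : ∀ n ∈ B, ¬ p n ∣ d n) (hR : ∀ n ∈ B, ∏ q ∈ (d n).primeFactors, q ≤ R)
    (hpR : ∀ n ∈ B, 2 * R ^ 2 ≤ p n) (hRw : ∀ n ∈ B, 2 * R ^ 2 * w ≤ n)
    (hmono : ∀ m ∈ B, ∀ n ∈ B, m ≤ n → Nat.totient m ≤ Nat.totient n)
    (hfib : ∀ u ∈ B, ∀ v ∈ B, u ≤ v →
      (({n ∈ B | (d n).primeFactors = (d u).primeFactors ∧ u ≤ n ∧ n ≤ v} : Finset ℕ).card : ℝ) ≤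
        κ * (v - u) + e) :
    (B.card : ℝ) ≤ κ * X + ((X / w + 1) * (R + 1) : ℕ) * e := by
  set f : ℕ → ℕ × ℝ := fun n => (n / w, totientRatio (d n).primeFactors) with hf
  have hratio : ∀ m ∈ B, ∀ n ∈ B, m ≤ n → m / w = n / w →
      totientRatio (d m).primeFactors ≤ totientRatio (d n).primeFactors := by
    intro m hm n hn hmn hdiv
    refine totientRatio_le_of_totient_le (hp m hm) (hp n hn) (hpd m hm) (hd m hm) (hR m hm)
      (hR n hn) (hpR m hm) ?_ ?_ ?_
    · rw [← hdp m hm, ← hdp n hn]; exact hmn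
    · rw [← hdp m hm, ← hdp n hn]
      refine lt_of_lt_of_le ?_ (hRw m hm)
      have hR0 : 0 < R := lt_of_lt_of_le
        (Finset.prod_pos fun q hq => (Nat.prime_of_mem_primeFactors hq).pos) (hR m hm)
      have h1 : n - m < w := by
        have h2 := Nat.div_add_mod m w
        have h3 := Nat.div_add_mod n w
        have h4 := Nat.mod_lt n hw
        rw [hdiv] at h2
        omega
      exact Nat.mul_lt_mul_of_pos_left h1 (by positivity)
    · rw [← hdp m hm, ← hdp n hn]; exact hmono m hm n hn hmn
  have key := card_le_of_convex_fibers (f := f) (B := B) hκ hX ?_ ?_ (e := e)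
  · refine key.trans (add_le_add le_rfl (mul_le_mul_of_nonneg_right ?_ he))
    rw [Nat.cast_le]
    have hsub : B.image f ⊆ Finset.range (X / w + 1) ×ˢ
        (Finset.range (R + 1)).image fun r => totientRatio r.primeFactors := by
      intro l hl
      obtain ⟨n, hn, rfl⟩ := Finset.mem_image.1 hl
      rw [Finset.mem_product]
      constructor
      · rw [Finset.mem_range, Nat.lt_succ_iff]
        exact Nat.div_le_div_right (hX n hn)
      · rw [Finset.mem_image]
        refine ⟨∏ q ∈ (d n).primeFactors, q, ?_, ?_⟩
        · rw [Finset.mem_range, Nat.lt_succ_iff]; exact hR n hn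
        · simp only [hf, Nat.primeFactors_prod_primeFactors]
    refine (Finset.card_le_card hsub).trans ?_
    rw [Finset.card_product, Finset.card_range]
    refine Nat.mul_le_mul_left _ (Finset.card_image_le.trans ?_)
    rw [Finset.card_range]
  · intro a ha b hb c hc hab hbc hac
    simp only [hf, Prod.mk.injEq] at hac ⊢
    have h1 : a / w ≤ b / w := Nat.div_le_div_right hab
    have h2 : b / w ≤ c / w := Nat.div_le_div_right hbc
    have h3 : b / w = a / w := by omega
    have h4 : b / w = c / w := by omega
    refine ⟨h3, le_antisymm ?_ (hratio a ha b hb hab h3.symm)⟩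
    rw [hac.2]
    exact hratio b hb c hc hbc h4
  · intro u hu v hv huv _
    refine le_trans ?_ (hfib u hu v hv huv)
    rw [Nat.cast_le]
    refine Finset.card_le_card fun n hn => ?_
    rw [Finset.mem_filter] at hn ⊢
    refine ⟨hn.1, ?_, hn.2.2⟩
    have := hn.2.1
    simp only [hf, Prod.mk.injEq] at this
    exact eq_of_totientRatio_eq (fun q hq => Nat.prime_of_mem_primeFactors hq)
      (fun q hq => Nat.prime_of_mem_primeFactors hq) this.2

open Classical in
/-- The number of `n ∈ [u, v]` of the form `k * p` with `p` prime. -/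
noncomputable def primeMultipleCount (k u v : ℕ) : ℕ :=
  ({n ∈ Finset.Icc u v | ∃ p, p.Prime ∧ n = k * p} : Finset ℕ).card

lemma primeMultipleCount_le_add_one {k u v : ℕ} (hk : 0 < k) (huv : u ≤ v) :
    (primeMultipleCount k u v : ℝ) ≤ (v - u : ℝ) * (k : ℝ)⁻¹ + 1 := by
  classical
  have h : primeMultipleCount k u v ≤ (v - u) / k + 1 := by
    rw [← Finset.card_range ((v - u) / k + 1)]
    refine Finset.card_le_card_of_injOn (fun n => (n - u) / k) (fun n hn => ?_) ?_
    · simp only [Finset.coe_filter, Finset.mem_Icc, Set.mem_ofPred_eq] at hn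
      rw [Finset.mem_coe, Finset.mem_range, Nat.lt_succ_iff]
      exact Nat.div_le_div_right (by omega)
    · have aux : ∀ a b : ℕ, u ≤ k * a → a < b → (k * a - u) / k < (k * b - u) / k := by
        intro a b ha hab
        have h1 : k * a - u + k ≤ k * b - u := by
          have : k * (a + 1) ≤ k * b := Nat.mul_le_mul_left k hab
          rw [mul_add, mul_one] at this
          omega
        calc (k * a - u) / k < (k * a - u) / k + 1 := Nat.lt_succ_self _
          _ = (k * a - u + k) / k := (Nat.add_div_right _ hk).symm
          _ ≤ _ := Nat.div_le_div_right h1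
      intro m hm n hn hmn
      simp only [Finset.coe_filter, Finset.mem_Icc, Set.mem_ofPred_eq] at hm hn
      obtain ⟨⟨hm1, -⟩, a, -, rfl⟩ := hm
      obtain ⟨⟨hn1, -⟩, b, -, rfl⟩ := hn
      rcases lt_trichotomy a b with h | h | h
      · exact absurd hmn (aux a b hm1 h).ne
      · rw [h]
      · exact absurd hmn (aux b a hn1 h).ne'
  have h2 : (((v - u) / k : ℕ) : ℝ) ≤ (v - u : ℝ) * (k : ℝ)⁻¹ := by
    rw [← div_eq_mul_inv]
    refine Nat.cast_div_le.trans ?_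
    rw [Nat.cast_sub huv]
  calc (primeMultipleCount k u v : ℝ) ≤ (((v - u) / k + 1 : ℕ) : ℝ) := by exact_mod_cast h
    _ ≤ _ := by push_cast at h2 ⊢; linarith

lemma primeMultipleCount_le_theta {k u v : ℕ} (hk : 0 < k) (hku : k < u) (huv : u ≤ v) :
    (primeMultipleCount k u v : ℝ) ≤
      1 + (Chebyshev.theta (v / k) - Chebyshev.theta (u / k)) / Real.log (u / k) := by
  classical
  have hk' : (0 : ℝ) < k := by exact_mod_cast hk
  have h1 : 1 < (u : ℝ) / k := by rw [one_lt_div hk']; exact_mod_cast hku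
  have hlog : 0 < Real.log ((u : ℝ) / k) := Real.log_pos h1
  set P := {p ∈ Finset.Ioc (u / k) (v / k) | p.Prime} with hP
  have hcard : primeMultipleCount k u v ≤ 1 + P.card := by
    rw [primeMultipleCount]
    have hsub : ({n ∈ Finset.Icc u v | ∃ p, p.Prime ∧ n = k * p} : Finset ℕ) ⊆
        (insert (u / k) P).image fun p => k * p := by
      intro n hn
      rw [Finset.mem_filter, Finset.mem_Icc] at hn
      obtain ⟨⟨hn1, hn2⟩, p, hp, rfl⟩ := hn
      refine Finset.mem_image.2 ⟨p, ?_, rfl⟩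
      have h3 : u / k ≤ p := Nat.div_le_of_le_mul hn1
      have h4 : p ≤ v / k := (Nat.le_div_iff_mul_le hk).2 (by rwa [mul_comm])
      rw [Finset.mem_insert]
      rcases h3.eq_or_lt with h5 | h5
      · exact Or.inl h5.symm
      · exact Or.inr (Finset.mem_filter.2 ⟨Finset.mem_Ioc.2 ⟨h5, h4⟩, hp⟩)
    calc _ ≤ _ := Finset.card_le_card hsub
      _ ≤ _ := Finset.card_image_le
      _ ≤ _ := Finset.card_insert_le _ _
      _ = _ := add_comm _ _
  have hsum : (P.card : ℝ) * Real.log ((u : ℝ) / k) ≤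
      Chebyshev.theta (v / k) - Chebyshev.theta (u / k) := by
    have hle : u / k ≤ v / k := Nat.div_le_div_right huv
    have e : Chebyshev.theta ((v : ℝ) / k) - Chebyshev.theta ((u : ℝ) / k) =
        ∑ p ∈ P, Real.log p := by
      rw [Chebyshev.theta, Chebyshev.theta, Nat.floor_div_eq_div, Nat.floor_div_eq_div, hP,
        Finset.sum_filter, Finset.sum_filter, Finset.sum_filter,
        ← Finset.sum_Ioc_consecutive _ (Nat.zero_le _) hle]
      ring
    rw [e, ← nsmul_eq_mul]
    refine Finset.card_nsmul_le_sum _ _ _ fun p hp => ?_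
    refine Real.log_le_log (by linarith) ?_
    rw [hP, Finset.mem_filter, Finset.mem_Ioc] at hp
    have h5 := hp.1.1
    rw [div_le_iff₀ hk']
    have : u < k * p := by
      rw [Nat.div_lt_iff_lt_mul hk] at h5
      rwa [mul_comm]
    have : (u : ℝ) ≤ ((k * p : ℕ) : ℝ) := by exact_mod_cast this.le
    push_cast at this
    linarith
  have h6 : (P.card : ℝ) ≤
      (Chebyshev.theta (v / k) - Chebyshev.theta (u / k)) / Real.log (u / k) := by
    rw [le_div_iff₀ hlog]; exact hsum
  have h7 : (primeMultipleCount k u v : ℝ) ≤ ((1 + P.card : ℕ) : ℝ) := by exact_mod_cast hcard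
  push_cast at h7
  linarith

lemma card_fiber_le_sum_primeMultipleCount {B : Finset ℕ} {d p : ℕ → ℕ} {D : ℕ}
    (hdp : ∀ n ∈ B, n = d n * p n) (hp : ∀ n ∈ B, (p n).Prime) (hd : ∀ n ∈ B, 0 < d n)
    (hD : ∀ n ∈ B, d n ≤ D) (s : Finset ℕ) (u v : ℕ) :
    ({n ∈ B | (d n).primeFactors = s ∧ u ≤ n ∧ n ≤ v} : Finset ℕ).card ≤
      ∑ k ∈ Finset.Icc 1 D with k.primeFactors = s, primeMultipleCount k u v := by
  classical
  refine le_trans (Finset.card_le_card (t := (Finset.Icc 1 D |>.filter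
    fun k => k.primeFactors = s).biUnion fun k => {n ∈ Finset.Icc u v | ∃ p, p.Prime ∧ n = k * p})
    fun n hn => ?_) ?_
  · rw [Finset.mem_filter] at hn
    obtain ⟨hnB, hs, hu, hv⟩ := hn
    refine Finset.mem_biUnion.2 ⟨d n, ?_, ?_⟩
    · exact Finset.mem_filter.2 ⟨Finset.mem_Icc.2 ⟨hd n hnB, hD n hnB⟩, hs⟩
    · exact Finset.mem_filter.2 ⟨Finset.mem_Icc.2 ⟨hu, hv⟩, p n, hp n hnB, hdp n hnB⟩
  · refine Finset.card_biUnion_le.trans (Finset.sum_le_sum fun k _ => le_of_eq ?_)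
    rw [primeMultipleCount]

/-- With `λ = log log x`, both `log x` and `exp (λ ^ 3)` are negligible powers of `x`. -/
lemma eventually_log_pow_mul_exp_le : ∀ᶠ x : ℝ in Filter.atTop,
    1 ≤ Real.log (Real.log x) ∧ 2 ≤ Real.log x ∧
    10 * Real.log (Real.log x) + Real.log (Real.log x) ^ 3 ≤ Real.log x / 2 ∧
    80 * Real.log x ^ 24 * Real.exp (Real.log (Real.log x) ^ 3) ^ 4 ≤ x := by
  filter_upwards [Real.tendsto_log_atTop.eventually (eventually_log_pow_le 4),
    (Real.tendsto_log_atTop.comp Real.tendsto_log_atTop).eventually_ge_atTop 40,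
    Real.tendsto_log_atTop.eventually_ge_atTop 2, Filter.eventually_gt_atTop 0] with x h1 h2 h3 hx
  simp only [Function.comp_apply] at h2
  set l := Real.log (Real.log x) with hl
  have h4 : 40 * l ^ 3 ≤ Real.log x := by
    have : 0 ≤ l ^ 3 := by positivity
    nlinarith
  have h5 : 1600 * l ≤ l ^ 3 := by nlinarith [sq_nonneg (l - 40)]
  refine ⟨by linarith, h3, by linarith, ?_⟩
  have e1 : Real.log x ^ 24 = Real.exp (24 * l) := by
    rw [hl, ← Real.exp_log (by positivity : 0 < Real.log x ^ 24), Real.log_pow]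
    norm_num
  have e2 : (80 : ℝ) ≤ Real.exp 79 := by
    have := Real.add_one_le_exp (79 : ℝ)
    linarith
  calc 80 * Real.log x ^ 24 * Real.exp (l ^ 3) ^ 4
      ≤ Real.exp 79 * Real.exp (24 * l) * Real.exp (4 * l ^ 3) := by
        rw [e1, ← Real.exp_nat_mul]
        push_cast
        gcongr
    _ = Real.exp (79 + 24 * l + 4 * l ^ 3) := by rw [Real.exp_add, Real.exp_add]
    _ ≤ Real.exp (Real.log x) := Real.exp_le_exp.2 (by nlinarith)
    _ = x := Real.exp_log hx

lemma eventually_primeMultipleCount_le : ∃ C : ℝ, 0 < C ∧ ∀ᶠ x : ℝ in Filter.atTop,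
    ∀ k u v : ℕ, 0 < k → (k : ℝ) ≤ Real.exp (Real.log (Real.log x) ^ 3) →
      x / Real.log x ^ 10 < u → u ≤ v → (v : ℝ) ≤ x →
      (primeMultipleCount k u v : ℝ) ≤ 1 +
        (1 / Real.log x + 20 * Real.log (Real.log x) / Real.log x ^ 2) * (v - u) * (k : ℝ)⁻¹ +
        2 / Real.log x ^ 2 * (v - u) * (Real.log k / k) + C * x / Real.log x ^ 24 * (k : ℝ)⁻¹ := by
  obtain ⟨C₀, hC₀, hθ⟩ := abs_theta_sub_le (A := 24) (by norm_num)
  obtain ⟨y₀, hy₀⟩ := Filter.eventually_atTop.1 hθ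
  refine ⟨2 ^ 25 * C₀, by positivity, ?_⟩
  filter_upwards [eventually_log_pow_mul_exp_le, Filter.eventually_ge_atTop (y₀ ^ 2),
    Filter.eventually_gt_atTop 1] with x ⟨hl1, hL2, hsmall, hbig⟩ hxy hx1 k u v hk hkD hu huv hvx
  set l := Real.log (Real.log x) with hl
  set D := Real.exp (l ^ 3) with hD
  have hx0 : 0 < x := by linarith
  have hL0 : 0 < Real.log x := by linarith
  have hk' : (0 : ℝ) < k := by exact_mod_cast hk
  have hk1 : (1 : ℝ) ≤ k := by exact_mod_cast hk
  have hD1 : 1 ≤ D := Real.one_le_exp (by positivity)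
  have huv' : (u : ℝ) ≤ v := by exact_mod_cast huv
  have hlogk : Real.log k ≤ l ^ 3 := (Real.log_le_iff_le_exp hk').2 hkD
  have hlogk0 : 0 ≤ Real.log k := Real.log_nonneg hk1
  have hu0 : (0 : ℝ) < u := lt_trans (by positivity) hu
  set t := 10 * l + Real.log k with ht
  have ht0 : 0 ≤ t := by positivity
  have ht2 : t ≤ Real.log x / 2 := by linarith
  have hlogu : Real.log x - t ≤ Real.log (u / k) := by
    have h1 := Real.log_le_log (by positivity) hu.le
    rw [Real.log_div hx0.ne' (by positivity), Real.log_pow] at h1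
    rw [Real.log_div hu0.ne' hk'.ne']
    push_cast at h1
    rw [ht, hl]
    linarith
  have hlogv : Real.log ((u : ℝ) / k) ≤ Real.log (v / k) :=
    Real.log_le_log (by positivity) (by gcongr)
  have hy : y₀ ≤ (u : ℝ) / k := by
    have h1 : √x ≤ (u : ℝ) / k := by
      have : Real.log √x ≤ Real.log (u / k) := by
        rw [Real.log_sqrt hx0.le]; linarith
      exact (Real.log_le_log_iff (Real.sqrt_pos.2 hx0) (by positivity)).1 this
    exact (Real.le_sqrt_of_sq_le hxy).trans h1
  have hyv : (u : ℝ) / k ≤ v / k := by gcongr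
  have hku : k < u := by
    have h1 : 0 < Real.log ((u : ℝ) / k) := by linarith
    have h2 := (Real.log_pos_iff (by positivity)).1 h1
    rw [one_lt_div hk'] at h2
    exact_mod_cast h2
  have herr : ∀ z : ℝ, (u : ℝ) / k ≤ z → z ≤ v / k →
      C₀ * z / Real.log z ^ 24 ≤ 2 ^ 24 * C₀ * (x * (k : ℝ)⁻¹) / Real.log x ^ 24 := by
    intro z hz1 hz2
    have hz0 : 0 < z := lt_of_lt_of_le (by positivity) hz1
    have h1 : Real.log x / 2 ≤ Real.log z := by
      have := Real.log_le_log (by positivity) hz1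
      linarith
    have h2 : z ≤ x * (k : ℝ)⁻¹ := by
      rw [← div_eq_mul_inv]
      exact hz2.trans (by gcongr)
    calc C₀ * z / Real.log z ^ 24 ≤ C₀ * (x * (k : ℝ)⁻¹) / (Real.log x / 2) ^ 24 := by gcongr
      _ = _ := by rw [div_pow]; field_simp
  have e1 := (abs_le.1 (hy₀ _ hy)).1
  have e2 := (abs_le.1 (hy₀ _ (hy.trans hyv))).2
  have e3 := herr _ le_rfl hyv
  have e4 := herr _ hyv le_rfl
  set G := 2 ^ 24 * C₀ * (x * (k : ℝ)⁻¹) / Real.log x ^ 24 with hG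
  have hG0 : 0 ≤ G := by positivity
  have hdiff : Chebyshev.theta (v / k) - Chebyshev.theta (u / k) ≤
      (v - u) * (k : ℝ)⁻¹ + 2 * G := by
    have : (v - u) * (k : ℝ)⁻¹ = (v : ℝ) / k - u / k := by ring
    linarith
  have hlogpos : 0 < Real.log ((u : ℝ) / k) := by linarith
  have hW : 0 ≤ ((v : ℝ) - u) * (k : ℝ)⁻¹ := mul_nonneg (by linarith) (by positivity)
  have hinv : 1 / Real.log ((u : ℝ) / k) ≤ 1 / Real.log x + 2 * t / Real.log x ^ 2 := by
    have h1 : 1 / Real.log ((u : ℝ) / k) ≤ 1 / (Real.log x - t) :=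
      one_div_le_one_div_of_le (by linarith) hlogu
    refine h1.trans ?_
    have h2 : 1 / Real.log x + 2 * t / Real.log x ^ 2 =
        (Real.log x + 2 * t) / Real.log x ^ 2 := by field_simp
    rw [h2, div_le_div_iff₀ (by linarith) (by positivity)]
    nlinarith
  have hinv1 : 1 / Real.log ((u : ℝ) / k) ≤ 1 := by
    rw [div_le_one hlogpos]; linarith
  have hmain := primeMultipleCount_le_theta hk hku huv
  have h3 : (Chebyshev.theta (v / k) - Chebyshev.theta (u / k)) / Real.log (u / k) ≤
      ((v - u) * (k : ℝ)⁻¹) * (1 / Real.log x + 2 * t / Real.log x ^ 2) + 2 * G := by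
    calc _ ≤ ((v - u) * (k : ℝ)⁻¹ + 2 * G) / Real.log (u / k) := by gcongr
      _ = ((v - u) * (k : ℝ)⁻¹) * (1 / Real.log (u / k)) + 2 * G * (1 / Real.log (u / k)) := by
          ring
      _ ≤ ((v - u) * (k : ℝ)⁻¹) * (1 / Real.log x + 2 * t / Real.log x ^ 2) + 2 * G * 1 := by
          gcongr
      _ = _ := by ring
  refine (hmain.trans (add_le_add le_rfl h3)).trans (le_of_eq ?_)
  rw [hG, ht]
  field_simp
  ring

lemma exists_window {x L : ℝ} {R : ℕ} (hL : 1 ≤ L) (hR : 0 < R) (hx : 2 * L * R ^ 2 ≤ x) :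
    ∃ w : ℕ, 0 < w ∧ 2 * (R : ℝ) ^ 2 * w ≤ x / L ∧
      (((⌊x⌋₊ / w + 1) * (R + 1) : ℕ) : ℝ) ≤ 10 * L * R ^ 3 := by
  have hR1 : (1 : ℝ) ≤ R := by exact_mod_cast hR
  have hL0 : 0 < L := by linarith
  have hx0 : 0 ≤ x := le_trans (by positivity) hx
  have hq : 1 ≤ x / (2 * L * R ^ 2) := by rwa [one_le_div (by positivity)]
  have hw : 0 < ⌊x / (2 * L * R ^ 2)⌋₊ := Nat.floor_pos.2 hq
  set w := ⌊x / (2 * L * R ^ 2)⌋₊ with hwdef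
  have hw0 : (0 : ℝ) < w := by exact_mod_cast hw
  have hw1 : (1 : ℝ) ≤ w := by exact_mod_cast hw
  have hle : (w : ℝ) ≤ x / (2 * L * R ^ 2) := Nat.floor_le (by positivity)
  have hlt : x / (2 * L * R ^ 2) < w + 1 := Nat.lt_floor_add_one _
  refine ⟨w, hw, ?_, ?_⟩
  · rw [le_div_iff₀ (by positivity)] at hle ⊢
    linarith
  · have h1 : ((⌊x⌋₊ / w : ℕ) : ℝ) ≤ 4 * L * R ^ 2 := by
      refine Nat.cast_div_le.trans ?_
      rw [div_le_iff₀ hw0]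
      refine (Nat.floor_le hx0).trans ?_
      rw [div_lt_iff₀ (by positivity)] at hlt
      have : ((w : ℝ) + 1) * (2 * L * R ^ 2) ≤ (2 * w) * (2 * L * R ^ 2) := by gcongr; linarith
      linarith
    have h2 : 1 ≤ L * (R : ℝ) ^ 2 := one_le_mul_of_one_le_of_one_le hL (one_le_pow₀ hR1)
    push_cast
    calc (((⌊x⌋₊ / w : ℕ) : ℝ) + 1) * ((R : ℝ) + 1)
        ≤ (4 * L * R ^ 2 + L * R ^ 2) * (R + R) := by gcongr
      _ = 10 * L * R ^ 3 := by ring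

/-- If every `(u, v)`-section of a class of multiples of primes by integers with the same prime
factors has at most `κ * (v - u) + e` elements, then a set of such multiples in `(x / L, x]` on
which the totient function is nondecreasing has at most `κ * x + 10 * L * R ^ 3 * e` elements. -/
lemma card_le_of_sum_primeMultipleCount_le {B : Finset ℕ} {d p : ℕ → ℕ} {x L D κ e : ℝ} {R : ℕ}
    (hκ : 0 ≤ κ) (he : 0 ≤ e) (hL : 1 ≤ L) (hD : 1 ≤ D) (hR0 : 0 < R)
    (hRx : 2 * L * R ^ 2 * D ≤ x) (hDx : D ^ 2 * L ≤ x)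
    (hx : ∀ n ∈ B, (n : ℝ) ≤ x) (hLx : ∀ n ∈ B, x / L < n)
    (hdp : ∀ n ∈ B, n = d n * p n) (hp : ∀ n ∈ B, (p n).Prime) (hd : ∀ n ∈ B, 0 < d n)
    (hdD : ∀ n ∈ B, (d n : ℝ) ≤ D) (hR : ∀ n ∈ B, ∏ q ∈ (d n).primeFactors, q ≤ R)
    (hmono : ∀ m ∈ B, ∀ n ∈ B, m ≤ n → Nat.totient m ≤ Nat.totient n)
    (hsum : ∀ u ∈ B, ∀ v ∈ B, u ≤ v →
      ∑ k ∈ Finset.Icc 1 ⌊D⌋₊ with k.primeFactors = (d u).primeFactors,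
        (primeMultipleCount k u v : ℝ) ≤ κ * (v - u) + e) :
    (B.card : ℝ) ≤ κ * x + 10 * L * R ^ 3 * e := by
  classical
  have hL0 : 0 < L := by linarith
  have hD0 : 0 < D := by linarith
  have hx0 : 0 ≤ x := le_trans (by positivity) hDx
  have hlarge : ∀ n ∈ B, ∀ y : ℝ, 0 ≤ y → y * L * D ≤ x → y < p n := by
    intro n hn y hy hyx
    have h1 := hLx n hn
    rw [hdp n hn, div_lt_iff₀ hL0] at h1
    push_cast at h1
    have h2 : (d n : ℝ) * p n * L ≤ D * p n * L := by gcongr; exact hdD n hn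
    have h3 : y * (L * D) < p n * (L * D) := by linarith
    exact lt_of_mul_lt_mul_right h3 (by positivity)
  obtain ⟨w, hw, hwx, hcount⟩ := exists_window hL hR0 (x := x) (R := R) (le_trans
    (le_mul_of_one_le_right (by positivity) hD) hRx)
  have key := card_le_of_totient_monotone (B := B) (d := d) (p := p) (X := ⌊x⌋₊) (R := R) hκ he hw
    (fun n hn => Nat.le_floor (hx n hn)) hdp hp hd ?_ hR ?_ ?_ hmono ?_
  · refine key.trans (add_le_add ?_ ?_)
    · exact mul_le_mul_of_nonneg_left (Nat.floor_le hx0) hκ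
    · exact mul_le_mul_of_nonneg_right hcount he
  · intro n hn hdvd
    have h1 : (p n : ℝ) ≤ d n := by exact_mod_cast Nat.le_of_dvd (hd n hn) hdvd
    have h2 := hlarge n hn D hD0.le (by linarith)
    linarith [hdD n hn]
  · intro n hn
    have h2 := hlarge n hn (2 * R ^ 2) (by positivity) (by linarith)
    exact_mod_cast h2.le
  · intro n hn
    have h2 := (hwx.trans_lt (hLx n hn)).le
    exact_mod_cast h2
  · intro u hu v hv huv
    refine le_trans ?_ (hsum u hu v hv huv)
    have h := card_fiber_le_sum_primeMultipleCount hdp hp hd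
      (fun n hn => Nat.le_floor (hdD n hn)) (d u).primeFactors u v
    have h' : ((({n ∈ B | (d n).primeFactors = (d u).primeFactors ∧ u ≤ n ∧ n ≤ v} :
      Finset ℕ).card : ℕ) : ℝ) ≤ _ := Nat.cast_le.2 h
    push_cast at h'
    convert h'

lemma sum_primeMultipleCount_le_of_forall_le {s : Finset ℕ} (hs : ∀ p ∈ s, p.Prime)
    {u v : ℕ} (huv : u ≤ v) {D a b c : ℝ} (hD : 0 ≤ D) (ha : 0 ≤ a) (hb : 0 ≤ b) (hc : 0 ≤ c)
    (h : ∀ k : ℕ, 0 < k → (k : ℝ) ≤ D → (primeMultipleCount k u v : ℝ) ≤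
      1 + a * (v - u) * (k : ℝ)⁻¹ + b * (v - u) * (Real.log k / k) + c * (k : ℝ)⁻¹) :
    ∑ k ∈ Finset.Icc 1 ⌊D⌋₊ with k.primeFactors = s, (primeMultipleCount k u v : ℝ) ≤
      (a + 8 * b) * (v - u) + (D + c) := by
  set E := {k ∈ Finset.Icc 1 ⌊D⌋₊ | k.primeFactors = s} with hEdef
  have hE : ∀ k ∈ E, k ≠ 0 ∧ k.primeFactors = s := by
    intro k hk
    rw [hEdef, Finset.mem_filter, Finset.mem_Icc] at hk
    exact ⟨by omega, hk.2⟩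
  have hcard : (E.card : ℝ) ≤ D := by
    refine le_trans ?_ (Nat.floor_le hD)
    have := Finset.card_filter_le (Finset.Icc 1 ⌊D⌋₊) fun k => k.primeFactors = s
    rw [Nat.card_Icc, Nat.add_sub_cancel] at this
    exact_mod_cast this
  have hW : (0 : ℝ) ≤ v - u := sub_nonneg.2 (by exact_mod_cast huv)
  calc ∑ k ∈ E, (primeMultipleCount k u v : ℝ)
      ≤ ∑ k ∈ E, (1 + a * (v - u) * (k : ℝ)⁻¹ + b * (v - u) * (Real.log k / k) +
          c * (k : ℝ)⁻¹) := by
        refine Finset.sum_le_sum fun k hk => ?_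
        rw [hEdef, Finset.mem_filter, Finset.mem_Icc] at hk
        exact h k hk.1.1 ((Nat.cast_le.2 hk.1.2).trans (Nat.floor_le hD))
    _ = E.card + a * (v - u) * ∑ k ∈ E, (k : ℝ)⁻¹ + b * (v - u) * ∑ k ∈ E, Real.log k / k +
          c * ∑ k ∈ E, (k : ℝ)⁻¹ := by
        simp only [Finset.sum_add_distrib, Finset.mul_sum, Finset.sum_const, nsmul_eq_mul, mul_one]
    _ ≤ D + a * (v - u) * 1 + b * (v - u) * 8 + c * 1 := by
        gcongr
        · exact sum_inv_le_one_of_primeFactors_eq hs hE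
        · exact sum_log_div_le_of_primeFactors_eq hs hE
        · exact sum_inv_le_one_of_primeFactors_eq hs hE
    _ = _ := by ring

lemma sum_primeMultipleCount_le_of_le_prod {s : Finset ℕ} (hs : ∀ p ∈ s, p.Prime)
    {u v : ℕ} (huv : u ≤ v) {D : ℝ} (hD : 0 ≤ D) {R : ℕ} (hR : 0 < R) (hRs : R ≤ ∏ p ∈ s, p) :
    ∑ k ∈ Finset.Icc 1 ⌊D⌋₊ with k.primeFactors = s, (primeMultipleCount k u v : ℝ) ≤
      4 / √R * (v - u) + D := by
  set E := {k ∈ Finset.Icc 1 ⌊D⌋₊ | k.primeFactors = s} with hEdef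
  have hE : ∀ k ∈ E, k ≠ 0 ∧ k.primeFactors = s := by
    intro k hk
    rw [hEdef, Finset.mem_filter, Finset.mem_Icc] at hk
    exact ⟨by omega, hk.2⟩
  have hcard : (E.card : ℝ) ≤ D := by
    refine le_trans ?_ (Nat.floor_le hD)
    have := Finset.card_filter_le (Finset.Icc 1 ⌊D⌋₊) fun k => k.primeFactors = s
    rw [Nat.card_Icc, Nat.add_sub_cancel] at this
    exact_mod_cast this
  have hW : (0 : ℝ) ≤ v - u := sub_nonneg.2 (by exact_mod_cast huv)
  calc ∑ k ∈ E, (primeMultipleCount k u v : ℝ)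
      ≤ ∑ k ∈ E, ((v - u) * (k : ℝ)⁻¹ + 1) := by
        refine Finset.sum_le_sum fun k hk => ?_
        exact primeMultipleCount_le_add_one (Nat.pos_of_ne_zero (hE k hk).1) huv
    _ = (v - u) * ∑ k ∈ E, (k : ℝ)⁻¹ + E.card := by
        simp only [Finset.sum_add_distrib, Finset.mul_sum, Finset.sum_const, nsmul_eq_mul, mul_one]
    _ ≤ (v - u) * (4 / √R) + D := by
        gcongr
        exact sum_inv_le_of_primeFactors_eq hs hE hR hRs
    _ = _ := by ring

lemma main_term_add_error_le {x ℓ l C D R Q : ℝ} (hℓ : 1 ≤ ℓ) (hl : 1 ≤ l) (hC : 0 ≤ C)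
    (hD : 1 ≤ D) (hR : ℓ ^ 4 ≤ R) (hR' : R ≤ 2 * ℓ ^ 4) (hQ0 : 0 ≤ Q) (hQ : Q ≤ D)
    (hbig : 80 * ℓ ^ 24 * D ^ 4 ≤ x) :
    ((1 / ℓ + 20 * l / ℓ ^ 2 + 8 * (2 / ℓ ^ 2)) * x +
      10 * ℓ ^ 10 * R ^ 3 * (D + C * x / ℓ ^ 24)) +
      (4 / √R * x + 10 * ℓ ^ 10 * Q ^ 3 * D) ≤
      (1 + (42 + 80 * C) * l / ℓ) * (x / ℓ) := by
  have hℓ0 : 0 < ℓ := by linarith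
  have hD0 : 0 < D := by linarith
  have hR0 : 0 < R := lt_of_lt_of_le (by positivity) hR
  have hx0 : 0 < x := lt_of_lt_of_le (by positivity) hbig
  have hDD : D ≤ D ^ 4 := le_self_pow₀ hD (by norm_num)
  have hS' : 10 * ℓ ^ 10 * R ^ 3 * (D + C * x / ℓ ^ 24) ≤ (1 + 80 * C) * (x / ℓ ^ 2) := by
    have h1 : 80 * ℓ ^ 22 * D ≤ x / ℓ ^ 2 := by
      rw [le_div_iff₀ (by positivity)]
      calc 80 * ℓ ^ 22 * D * ℓ ^ 2 = 80 * ℓ ^ 24 * D := by ring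
        _ ≤ 80 * ℓ ^ 24 * D ^ 4 := by gcongr
        _ ≤ x := hbig
    calc 10 * ℓ ^ 10 * R ^ 3 * (D + C * x / ℓ ^ 24)
        ≤ 10 * ℓ ^ 10 * (2 * ℓ ^ 4) ^ 3 * (D + C * x / ℓ ^ 24) := by gcongr
      _ = 80 * ℓ ^ 22 * D + 80 * C * (x / ℓ ^ 2) := by field_simp; norm_num
      _ ≤ x / ℓ ^ 2 + 80 * C * (x / ℓ ^ 2) := by gcongr
      _ = _ := by ring
  have hT' : 10 * ℓ ^ 10 * Q ^ 3 * D ≤ x / ℓ ^ 2 := by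
    rw [le_div_iff₀ (by positivity)]
    calc 10 * ℓ ^ 10 * Q ^ 3 * D * ℓ ^ 2 ≤ 10 * ℓ ^ 10 * D ^ 3 * D * ℓ ^ 2 := by gcongr
      _ = 10 * ℓ ^ 12 * D ^ 4 := by ring
      _ ≤ 80 * ℓ ^ 24 * D ^ 4 := by
          gcongr
          · norm_num
          · norm_num
      _ ≤ x := hbig
  have hκT : 4 / √R * x ≤ 4 * (x / ℓ ^ 2) := by
    have h1 : ℓ ^ 2 ≤ √R := by
      refine Real.le_sqrt_of_sq_le ?_
      rw [← pow_mul]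
      exact hR
    calc 4 / √R * x ≤ 4 / ℓ ^ 2 * x := by gcongr
      _ = _ := by ring
  have hfinal : (1 + (42 + 80 * C) * l / ℓ) * (x / ℓ) =
      x / ℓ + (42 * l + 80 * C * l) * (x / ℓ ^ 2) := by field_simp
  have hκS : ((1 / ℓ + 20 * l / ℓ ^ 2) + 8 * (2 / ℓ ^ 2)) * x =
      x / ℓ + (20 * l + 16) * (x / ℓ ^ 2) := by field_simp; ring
  have hlast : (20 * l + 16 + (1 + 80 * C) + 4 + 1) * (x / ℓ ^ 2) ≤
      (42 * l + 80 * C * l) * (x / ℓ ^ 2) := by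
    refine mul_le_mul_of_nonneg_right ?_ (by positivity)
    nlinarith [mul_nonneg hC (sub_nonneg.2 hl)]
  rw [hκS, hfinal]
  linarith

lemma eventually_card_le_of_subset_inA1 : ∃ C : ℝ, 0 < C ∧ ∀ᶠ x : ℝ in Filter.atTop,
    ∀ B : Finset ℕ, (∀ n ∈ B, (n : ℝ) ≤ x ∧ inA1 x n) →
      (∀ m ∈ B, ∀ n ∈ B, m ≤ n → Nat.totient m ≤ Nat.totient n) →
      (B.card : ℝ) ≤ (1 + C * Real.log (Real.log x) / Real.log x) * (x / Real.log x) := by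
  obtain ⟨C, hC, hcount⟩ := eventually_primeMultipleCount_le
  refine ⟨42 + 80 * C, by positivity, ?_⟩
  filter_upwards [hcount, eventually_log_pow_mul_exp_le] with x hcount hlarge B hB hmono
  obtain ⟨hl1, hL2, -, hbig⟩ := hlarge
  have hx : ∀ n ∈ B, (n : ℝ) ≤ x := fun n hn => (hB n hn).1
  have hLx : ∀ n ∈ B, x / Real.log x ^ 10 < n := fun n hn => (hB n hn).2.1
  choose! d p hdp _ hdD hp using fun n hn => (hB n hn).2.2
  simp only [Dx] at hdD
  set l := Real.log (Real.log x) with hl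
  set ℓ := Real.log x with hℓ
  set D := Real.exp (l ^ 3) with hDdef
  have hD1 : 1 ≤ D := Real.one_le_exp (by positivity)
  have hD0 : 0 < D := by linarith
  have hx0 : 0 < x := lt_of_lt_of_le (by positivity) hbig
  have hℓ1 : 1 ≤ ℓ := by linarith
  have hd : ∀ n ∈ B, 0 < d n := by
    intro n hn
    refine Nat.pos_of_ne_zero fun h0 => ?_
    have h1 := hLx n hn
    rw [hdp n hn, h0, zero_mul, Nat.cast_zero] at h1
    exact absurd h1 (not_lt.2 (by positivity))
  have hprime : ∀ n, ∀ q ∈ (d n).primeFactors, q.Prime := fun n q hq =>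
    Nat.prime_of_mem_primeFactors hq
  obtain ⟨R, hR4, hRle, hR0⟩ : ∃ R : ℕ, ℓ ^ 4 ≤ R ∧ (R : ℝ) ≤ 2 * ℓ ^ 4 ∧ 0 < R := by
    refine ⟨⌈ℓ ^ 4⌉₊, Nat.le_ceil _, ?_, Nat.ceil_pos.2 (by positivity)⟩
    have h1 := (Nat.ceil_lt_add_one (by positivity : (0 : ℝ) ≤ ℓ ^ 4)).le
    have h2 : 1 ≤ ℓ ^ 4 := one_le_pow₀ hℓ1
    linarith
  have hQ0 : 0 < ⌊D⌋₊ := Nat.floor_pos.2 hD1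
  have hQle : (⌊D⌋₊ : ℝ) ≤ D := Nat.floor_le hD0.le
  have hsub : ∀ {P : ℕ → Prop} [DecidablePred P] {n : ℕ}, n ∈ B.filter P → n ∈ B := fun h =>
    (Finset.mem_filter.1 h).1
  have hDpow : D ^ 2 ≤ D ^ 4 ∧ D ≤ D ^ 4 ∧ D ^ 3 ≤ D ^ 4 :=
    ⟨pow_le_pow_right₀ hD1 (by norm_num), le_self_pow₀ hD1 (by norm_num),
      pow_le_pow_right₀ hD1 (by norm_num)⟩
  have hℓpow : ∀ m ≤ 24, ℓ ^ m ≤ ℓ ^ 24 := fun m hm => pow_le_pow_right₀ hℓ1 hm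
  have hDℓ : D ^ 2 * ℓ ^ 10 ≤ x := by
    have h1 : D ^ 2 * ℓ ^ 10 ≤ D ^ 4 * ℓ ^ 24 :=
      mul_le_mul hDpow.1 (hℓpow 10 (by norm_num)) (by positivity) (by positivity)
    have h2 : 0 ≤ D ^ 4 * ℓ ^ 24 := by positivity
    linarith
  have hκ0 : 0 ≤ 1 / ℓ + 20 * l / ℓ ^ 2 := by positivity
  have hκ1 : 0 ≤ 2 / ℓ ^ 2 := by positivity
  have hC0 : 0 ≤ C * x / ℓ ^ 24 := by positivity
  have hL1 : 1 ≤ ℓ ^ 10 := one_le_pow₀ hℓ1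
  have hS := card_le_of_sum_primeMultipleCount_le (B := {n ∈ B | ∏ q ∈ (d n).primeFactors, q ≤ R})
    (d := d) (p := p) (x := x) (L := ℓ ^ 10) (D := D) (R := R)
    (κ := (1 / ℓ + 20 * l / ℓ ^ 2) + 8 * (2 / ℓ ^ 2)) (e := D + C * x / ℓ ^ 24)
    (add_nonneg hκ0 (mul_nonneg (by norm_num) hκ1)) (add_nonneg hD0.le hC0) hL1 hD1 hR0 ?_ hDℓ
    (fun n hn => hx n (hsub hn)) (fun n hn => hLx n (hsub hn)) (fun n hn => hdp n (hsub hn))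
    (fun n hn => hp n (hsub hn)) (fun n hn => hd n (hsub hn)) (fun n hn => hdD n (hsub hn))
    (fun n hn => (Finset.mem_filter.1 hn).2)
    (fun m hm n hn => hmono m (hsub hm) n (hsub hn))
    (fun u hu v hv huv => sum_primeMultipleCount_le_of_forall_le (hprime u) huv hD0.le
      hκ0 hκ1 hC0 fun k hk hkD => hcount k u v hk hkD (hLx u (hsub hu)) huv (hx v (hsub hv)))
  swap
  · calc 2 * ℓ ^ 10 * (R : ℝ) ^ 2 * D ≤ 2 * ℓ ^ 10 * (2 * ℓ ^ 4) ^ 2 * D := by gcongr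
      _ = 8 * (ℓ ^ 18 * D) := by ring
      _ ≤ 8 * (ℓ ^ 24 * D ^ 4) := by
          gcongr 8 * (?_ * ?_)
          · exact hℓpow 18 (by norm_num)
          · exact hDpow.2.1
      _ ≤ x := by
          have h2 : 0 ≤ ℓ ^ 24 * D ^ 4 := by positivity
          linarith
  have hT := card_le_of_sum_primeMultipleCount_le
    (B := {n ∈ B | ¬ ∏ q ∈ (d n).primeFactors, q ≤ R})
    (d := d) (p := p) (x := x) (L := ℓ ^ 10) (D := D) (R := ⌊D⌋₊)
    (κ := 4 / √R) (e := D)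
    (by positivity) hD0.le hL1 hD1 hQ0 ?_ hDℓ
    (fun n hn => hx n (hsub hn)) (fun n hn => hLx n (hsub hn)) (fun n hn => hdp n (hsub hn))
    (fun n hn => hp n (hsub hn)) (fun n hn => hd n (hsub hn)) (fun n hn => hdD n (hsub hn))
    (fun n hn => (Nat.le_of_dvd (hd n (hsub hn)) (Nat.prod_primeFactors_dvd _)).trans
      (Nat.le_floor (hdD n (hsub hn))))
    (fun m hm n hn => hmono m (hsub hm) n (hsub hn))
    (fun u hu v hv huv => sum_primeMultipleCount_le_of_le_prod (hprime u) huv hD0.le hR0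
      (not_le.1 (Finset.mem_filter.1 hu).2).le)
  swap
  · calc 2 * ℓ ^ 10 * (⌊D⌋₊ : ℝ) ^ 2 * D ≤ 2 * ℓ ^ 10 * D ^ 2 * D := by gcongr
      _ = 2 * (ℓ ^ 10 * D ^ 3) := by ring
      _ ≤ 2 * (ℓ ^ 24 * D ^ 4) := by
          gcongr 2 * (?_ * ?_)
          · exact hℓpow 10 (by norm_num)
          · exact hDpow.2.2
      _ ≤ x := by
          have h2 : 0 ≤ ℓ ^ 24 * D ^ 4 := by positivity
          linarith
  have hcardB : (B.card : ℝ) = ({n ∈ B | ∏ q ∈ (d n).primeFactors, q ≤ R} : Finset ℕ).card +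
      ({n ∈ B | ¬ ∏ q ∈ (d n).primeFactors, q ≤ R} : Finset ℕ).card := by
    exact_mod_cast (Finset.card_filter_add_card_filter_not _).symm
  rw [hcardB]
  exact (add_le_add hS hT).trans (main_term_add_error_le hℓ1 hl1 hC.le hD1 hR4 hRle
    (Nat.cast_nonneg _) hQle hbig)

theorem stmt10 : ∃ C : ℝ, 0 < C ∧ ∃ x₀ : ℝ, ∀ x : ℝ, x₀ ≤ x →
    (M {n : ℕ | (n : ℝ) ≤ x ∧ inA1 x n} : ℝ) ≤
      (1 + C * Real.log (Real.log x) / Real.log x) * (x / Real.log x) := by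
  obtain ⟨C, hC, h⟩ := eventually_card_le_of_subset_inA1
  obtain ⟨x₀, hx₀⟩ := Filter.eventually_atTop.1 h
  refine ⟨C, hC, x₀, fun x hx => ?_⟩
  have hY := hx₀ x hx ∅ (by simp) (by simp)
  rw [Finset.card_empty, Nat.cast_zero] at hY
  refine (Nat.le_floor_iff hY).1 (csSup_le' ?_)
  rintro k ⟨B, hBA, hmono, rfl⟩
  exact Nat.le_floor (hx₀ x hx B (fun n hn => hBA hn) hmono)
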